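/- Let Δ ≥ 7 be an integer and let G be a minimal counterexample to the bound χ'_s ≤ 3Δ for graphs with Mad ≤ 3, maximum degree at most Δ, and no 3-regular subgraph. Then no vertex is a sponsor of two distinct very poor vertices. -/

import Mathlib

open scoped Classical

namespace StrongEC

/-- Two edges of `G` conflict for strong edge-coloring: they are distinct and either share
an endpoint or are both adjacent to a common edge of `G`. -/
def Conflict {V : Type*} (G : SimpleGraph V) (e e' : Sym2 V) : Prop :=
  e ≠ e' ∧ ((∃ v, v ∈ e ∧ v ∈ e') ∨
    ∃ f ∈ G.edgeSet, (∃ v, v ∈ e ∧ v ∈ f) ∧ (∃ w, w ∈ e' ∧ w ∈ f))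

/-- `C` is a strong edge-coloring of `G` with `k` colors. -/
def IsStrongColoring {V : Type*} (G : SimpleGraph V) {k : ℕ} (C : Sym2 V → Fin k) : Prop :=
  ∀ e ∈ G.edgeSet, ∀ e' ∈ G.edgeSet, Conflict G e e' → C e ≠ C e'

/-- `G` admits a strong `k`-edge-coloring. -/
def HasStrongColoring {V : Type*} (G : SimpleGraph V) (k : ℕ) : Prop :=
  ∃ C : Sym2 V → Fin k, IsStrongColoring G C

/-- The strong chromatic index of `G`: the least `k` such that `G` admits a strong
`k`-edge-coloring. -/
noncomputable def strongChromaticIndex {V : Type*} (G : SimpleGraph V) : ℕ :=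
  sInf {k | HasStrongColoring G k}

/-- The maximum average degree of a finite graph `G`: the supremum over nonempty vertex
subsets `A` of `2 * e(A) / |A|`, where `e(A)` is the number of edges of `G` inside `A`
(this equals the maximum of `2|E(H)|/|V(H)|` over all subgraphs `H` with at least one
vertex). -/
noncomputable def mad {V : Type*} (G : SimpleGraph V) : ℝ :=
  sSup {x : ℝ | ∃ A : Finset V, A.Nonempty ∧
    x = 2 * ({e ∈ G.edgeSet | ∀ v ∈ e, v ∈ A}.ncard : ℝ) / (A.card : ℝ)}

/-- `G` has a 3-regular subgraph: a subgraph on a nonempty vertex set all of whose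
vertices have degree exactly 3 in it. -/
def Has3RegularSubgraph {V : Type*} (G : SimpleGraph V) : Prop :=
  ∃ H : SimpleGraph V, H ≤ G ∧ H.support.Nonempty ∧
    ∀ v ∈ H.support, (H.neighborSet v).ncard = 3

/-- The graph `G*` obtained from `G` by deleting all vertices of degree 1 in `G`. -/
noncomputable def core {V : Type*} [Fintype V] (G : SimpleGraph V) : SimpleGraph V :=
  SimpleGraph.fromRel (fun u v => G.Adj u v ∧ G.degree u ≠ 1 ∧ G.degree v ≠ 1)

/-- The number of vertices of degree at least 2. -/
noncomputable def twoPlusCount {W : Type} [Fintype W] (H : SimpleGraph W) : ℕ :=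
  (Finset.univ.filter (fun v : W => 2 ≤ H.degree v)).card

/-- A graph with maximum average degree at most `3`, maximum degree at most `Δ`, and no
3-regular subgraph. -/
def GoodB (Δ : ℕ) {W : Type} [Fintype W] (H : SimpleGraph W) : Prop :=
  mad H ≤ 3 ∧ H.maxDegree ≤ Δ ∧ ¬ Has3RegularSubgraph H

/-- `G` is a minimal counterexample to the bound `χ'_s ≤ 3Δ` for graphs with `Mad ≤ 3`,
maximum degree at most `Δ` and no 3-regular subgraph. -/
def MinCexB (Δ : ℕ) {V : Type} [Fintype V] (G : SimpleGraph V) : Prop :=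
  GoodB Δ G ∧ ¬ HasStrongColoring G (3 * Δ) ∧
    ∀ (W : Type) [Fintype W] (H : SimpleGraph W), GoodB Δ H →
      (twoPlusCount H < twoPlusCount G ∨
        (twoPlusCount H = twoPlusCount G ∧ H.edgeSet.ncard < G.edgeSet.ncard)) →
      HasStrongColoring H (3 * Δ)

/-- A poor 3-vertex: a vertex of degree 3 in `G*` exactly one of whose neighbors in `G*`
has degree 2 in `G*`. -/
def Poor3 {V : Type} [Fintype V] (G : SimpleGraph V) (v : V) : Prop :=
  (core G).degree v = 3 ∧
    (((core G).neighborFinset v).filter (fun u => (core G).degree u = 2)).card = 1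

/-- `u` is a very poor vertex with sponsor `v` and rival `w`: `u` has degree 2 in `G*`
with neighbors `v` and `w` in `G*`, and one of (T1), (T2), (T3) holds for `w`. -/
def VeryPoorWith {V : Type} [Fintype V] (G : SimpleGraph V) (u v w : V) : Prop :=
  (core G).degree u = 2 ∧ (core G).Adj u v ∧ (core G).Adj u w ∧ v ≠ w ∧
    ((core G).degree w = 2 ∨
      ((core G).degree w = 3 ∧
        2 ≤ (((core G).neighborFinset w).filter (fun x => (core G).degree x = 2)).card) ∨
      ((core G).degree w = 4 ∧
        (((core G).neighborFinset w).filter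
          (fun x => ¬ ((core G).degree x = 2 ∨ Poor3 G x))).card ≤ 1))

theorem conflict_symm {V : Type*} {G : SimpleGraph V} {e e' : Sym2 V}
    (h : Conflict G e e') : Conflict G e' e := by
  obtain ⟨hne, h⟩ := h
  refine ⟨hne.symm, ?_⟩
  rcases h with ⟨v, h1, h2⟩ | ⟨f, hf, h1, h2⟩
  · exact Or.inl ⟨v, h2, h1⟩
  · exact Or.inr ⟨f, hf, h2, h1⟩

/-- `C` is a proper partial strong coloring on the edge set `E`. -/
def ValidOn {V : Type*} (G : SimpleGraph V) {k : ℕ} (E : Set (Sym2 V))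
    (C : Sym2 V → Fin k) : Prop :=
  ∀ e ∈ E, ∀ e' ∈ E, Conflict G e e' → C e ≠ C e'

theorem exists_color {V : Type*} {k : ℕ} (C : Sym2 V → Fin k) (S : Finset (Sym2 V))
    (hS : S.card < k) : ∃ c : Fin k, ∀ e ∈ S, C e ≠ c := by
  by_contra! h
  have h1 : (Finset.univ : Finset (Fin k)) ⊆ S.image C := by
    intro c _
    obtain ⟨e, he, hc⟩ := h c
    exact Finset.mem_image.2 ⟨e, he, hc⟩
  have h2 := Finset.card_le_card h1
  have h3 := Finset.card_image_le (s := S) (f := C)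
  simp at h2
  omega

theorem valid_update {V : Type*} {G : SimpleGraph V} {k : ℕ} {E : Set (Sym2 V)}
    {C : Sym2 V → Fin k} (hC : ValidOn G E C) (e : Sym2 V) (c : Fin k)
    (hc : ∀ e' ∈ E, Conflict G e e' → C e' ≠ c) :
    ValidOn G (insert e E) (Function.update C e c) := by
  intro a ha b hb hab
  by_cases h1 : a = e
  · subst h1
    have hba : b ≠ a := fun h => hab.1 h.symm
    rw [Function.update_self, Function.update_of_ne hba]
    exact (hc b (hb.resolve_left hba) hab).symm
  · by_cases h2 : b = e
    · subst h2
      rw [Function.update_self, Function.update_of_ne h1]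
      exact hc a (ha.resolve_left h1) (conflict_symm hab)
    · rw [Function.update_of_ne h1, Function.update_of_ne h2]
      exact hC a (ha.resolve_left h1) b (hb.resolve_left h2) hab

theorem valid_extend {V : Type*} {G : SimpleGraph V} {k : ℕ} {E : Set (Sym2 V)}
    (C : Sym2 V → Fin k) (hC : ValidOn G E C) (L : Finset (Sym2 V))
    (hL : ∀ e ∈ L, ∃ S : Finset (Sym2 V), S.card < k ∧
      ∀ e' ∈ E ∪ (L : Set (Sym2 V)), Conflict G e e' → e' ∈ S) :
    ∃ C' : Sym2 V → Fin k, ValidOn G (E ∪ (L : Set (Sym2 V))) C' := by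
  induction L using Finset.induction_on with
  | empty => exact ⟨C, by simpa using hC⟩
  | insert e L heL ih =>
    obtain ⟨C', hC'⟩ := ih (by
      intro a ha
      obtain ⟨S, hS, h⟩ := hL a (Finset.mem_insert_of_mem ha)
      refine ⟨S, hS, fun e' he' hc => h e' ?_ hc⟩
      rcases he' with h' | h'
      · exact Or.inl h'
      · exact Or.inr (by simpa using Or.inr h'))
    obtain ⟨S, hS, h⟩ := hL e (Finset.mem_insert_self _ _)
    obtain ⟨c, hc⟩ := exists_color C' S hS
    refine ⟨Function.update C' e c, ?_⟩
    have h2 : E ∪ ((insert e L : Finset (Sym2 V)) : Set (Sym2 V))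
        = insert e (E ∪ (L : Set (Sym2 V))) := by
      ext x; simp
    rw [h2]
    refine valid_update hC' e c (fun e' he' hcf => hc e' (h e' ?_ hcf))
    rw [h2]; exact Or.inr he'

/-- Upper bound of the edges conflicting with `xy`. -/
noncomputable def confSet {V : Type} [Fintype V] (G : SimpleGraph V) (x y : V) :
    Finset (Sym2 V) :=
  ((G.neighborFinset x).erase y).biUnion (fun a => G.incidenceFinset a) ∪
    ((G.neighborFinset y).erase x).biUnion (fun a => G.incidenceFinset a)

theorem confSet_symm {V : Type} [Fintype V] (G : SimpleGraph V) (x y : V) :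
    confSet G x y = confSet G y x := by
  unfold confSet; rw [Finset.union_comm]

theorem mem_confSet_of_adj {V : Type} [Fintype V] {G : SimpleGraph V} {x y a : V}
    (ha : G.Adj x a) (hay : a ≠ y) {e : Sym2 V} (he : e ∈ G.edgeSet) (hae : a ∈ e) :
    e ∈ confSet G x y := by
  unfold confSet
  refine Finset.mem_union_left _ (Finset.mem_biUnion.2 ⟨a, ?_, ?_⟩)
  · simp [hay, ha]
  · simp only [SimpleGraph.mem_incidenceFinset]
    exact ⟨he, hae⟩

theorem mem_confSet {V : Type} [Fintype V] {G : SimpleGraph V} {x y : V}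
    {e' : Sym2 V} (he' : e' ∈ G.edgeSet)
    (h : Conflict G s(x, y) e') : e' ∈ confSet G x y := by
  have key : ∀ x y : V, s(x, y) ≠ e' → x ∈ e' → e' ∈ confSet G x y := by
    intro x y hne hx
    obtain ⟨b, rfl⟩ := hx
    have hb : G.Adj x b := he'
    refine mem_confSet_of_adj hb ?_ he' (by simp)
    rintro rfl; exact hne rfl
  have key2 : ∀ x y : V, s(x, y) ≠ e' → ∀ f ∈ G.edgeSet, x ∈ f → ∀ w, w ∈ e' → w ∈ f →
      e' ∈ confSet G x y := by
    intro x y hne f hf hx w hw hwf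
    by_cases hwx : w = x
    · subst hwx; exact key _ _ hne hw
    by_cases hwy : w = y
    · subst hwy; rw [confSet_symm]; exact key _ _ (by rwa [Sym2.eq_swap]) hw
    have : f = s(x, w) := ((Sym2.mem_and_mem_iff (Ne.symm hwx)).1 ⟨hx, hwf⟩)
    subst this
    exact mem_confSet_of_adj hf hwy he' hw
  obtain ⟨hne, ⟨t, ht, ht'⟩ | ⟨f, hf, ⟨t, ht, htf⟩, ⟨w, hw, hwf⟩⟩⟩ := h
  · rcases Sym2.mem_iff.1 ht with rfl | rfl
    · exact key _ _ hne ht'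
    · rw [confSet_symm]; exact key _ _ (by rwa [Sym2.eq_swap]) ht'
  · rcases Sym2.mem_iff.1 ht with rfl | rfl
    · exact key2 _ _ hne f hf htf w hw hwf
    · rw [confSet_symm]; exact key2 _ _ (by rwa [Sym2.eq_swap]) f hf htf w hw hwf

theorem card_confSet {V : Type} [Fintype V] (G : SimpleGraph V) (x y : V) :
    (confSet G x y).card ≤ ∑ a ∈ (G.neighborFinset x).erase y, G.degree a +
      ∑ a ∈ (G.neighborFinset y).erase x, G.degree a := by
  unfold confSet
  refine (Finset.card_union_le _ _).trans (add_le_add ?_ ?_) <;>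
  · refine Finset.card_biUnion_le.trans (le_of_eq ?_)
    exact Finset.sum_congr rfl (fun a _ => by rw [SimpleGraph.card_incidenceFinset_eq_degree])

/-- Number of edges inside `A`. -/
noncomputable def eIn {V : Type} [Fintype V] (G : SimpleGraph V) (A : Finset V) : ℕ :=
  (G.edgeFinset.filter (fun e => ∀ v ∈ e, v ∈ A)).card

theorem eIn_ncard {V : Type} [Fintype V] (G : SimpleGraph V) (A : Finset V) :
    {e ∈ G.edgeSet | ∀ v ∈ e, v ∈ A}.ncard = eIn G A := by
  unfold eIn
  rw [← Set.ncard_coe_finset]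
  congr 1
  ext e; simp

theorem mad_le_iff {V : Type} [Fintype V] (G : SimpleGraph V) :
    mad G ≤ 3 ↔ ∀ A : Finset V, 2 * eIn G A ≤ 3 * A.card := by
  unfold mad
  simp only [eIn_ncard]
  constructor
  · intro h A
    rcases A.eq_empty_or_nonempty with rfl | hA
    · have : eIn G ∅ = 0 := by
        unfold eIn
        rw [Finset.card_eq_zero, Finset.filter_eq_empty_iff]
        intro e _ h
        induction e with
        | h x y => simpa using h x (by simp)
      simp [this]
    · have hb : BddAbove {x : ℝ | ∃ A : Finset V, A.Nonempty ∧
          x = 2 * (eIn G A : ℝ) / (A.card : ℝ)} := by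
        refine Set.Finite.bddAbove ?_
        refine (Set.finite_range (fun A : Finset V => 2 * (eIn G A : ℝ) / (A.card : ℝ))).subset ?_
        rintro x ⟨A, _, rfl⟩; exact ⟨A, rfl⟩
      have h1 := (le_csSup hb ⟨A, hA, rfl⟩).trans h
      have hp : (0 : ℝ) < A.card := by exact_mod_cast hA.card_pos
      rw [div_le_iff₀ hp] at h1
      exact_mod_cast h1
  · intro h
    refine Real.sSup_le ?_ (by norm_num)
    rintro x ⟨A, hA, rfl⟩
    have hp : (0 : ℝ) < A.card := by exact_mod_cast hA.card_pos
    rw [div_le_iff₀ hp]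
    exact_mod_cast h A

theorem eIn_mono {V : Type} [Fintype V] {G H : SimpleGraph V} (h : H ≤ G) (A : Finset V) :
    eIn H A ≤ eIn G A := by
  refine Finset.card_le_card ?_
  intro e he
  simp only [Finset.mem_filter, SimpleGraph.mem_edgeFinset] at he ⊢
  exact ⟨SimpleGraph.edgeSet_mono h he.1, he.2⟩

theorem eIn_super {V : Type} [Fintype V] (G : SimpleGraph V) (A B : Finset V) :
    eIn G A + eIn G B ≤ eIn G (A ∪ B) + eIn G (A ∩ B) := by
  unfold eIn
  rw [← Finset.card_union_add_card_inter]
  refine add_le_add (Finset.card_le_card ?_) (Finset.card_le_card ?_)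
  · intro e he
    simp only [Finset.mem_union, Finset.mem_filter] at he ⊢
    rcases he with he | he
    · exact ⟨he.1, fun v hv => Or.inl (he.2 v hv)⟩
    · exact ⟨he.1, fun v hv => Or.inr (he.2 v hv)⟩
  · intro e he
    simp only [Finset.mem_inter, Finset.mem_filter] at he ⊢
    exact ⟨he.1.1, fun v hv => ⟨he.1.2 v hv, he.2.2 v hv⟩⟩

theorem eIn_le_erase {V : Type} [Fintype V] (G : SimpleGraph V) (A : Finset V) (u : V) :
    eIn G A ≤ eIn G (A.erase u) + G.degree u := by
  unfold eIn
  rw [← SimpleGraph.card_incidenceFinset_eq_degree]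
  refine (Finset.card_le_card ?_).trans (Finset.card_union_le _ _)
  intro e he
  simp only [Finset.mem_union, Finset.mem_filter, SimpleGraph.mem_edgeFinset,
    SimpleGraph.mem_incidenceFinset, Finset.mem_erase] at he ⊢
  by_cases hu : u ∈ e
  · exact Or.inr ⟨he.1, hu⟩
  · refine Or.inl ⟨he.1, fun v hv => ⟨?_, he.2 v hv⟩⟩
    rintro rfl; exact hu hv

theorem degree_mono {V : Type} [Fintype V] {G H : SimpleGraph V} (h : H ≤ G) (x : V) :
    H.degree x ≤ G.degree x := by
  refine Finset.card_le_card ?_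
  intro y hy
  simp only [SimpleGraph.mem_neighborFinset] at hy ⊢
  exact h hy

theorem goodB_of {V : Type} [Fintype V] {Δ : ℕ} {G H : SimpleGraph V} (hG : GoodB Δ G)
    (hm : ∀ A : Finset V, 2 * eIn H A ≤ 3 * A.card)
    (hd : ∀ x, H.degree x ≤ G.degree x) (h3 : ¬ Has3RegularSubgraph H) : GoodB Δ H := by
  refine ⟨(mad_le_iff H).2 hm, ?_, h3⟩
  refine SimpleGraph.maxDegree_le_of_forall_degree_le _ _ (fun x => ?_)
  exact (hd x).trans ((G.degree_le_maxDegree x).trans hG.2.1)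

theorem goodB_mono {V : Type} [Fintype V] {Δ : ℕ} {G H : SimpleGraph V} (hG : GoodB Δ G)
    (h : H ≤ G) : GoodB Δ H := by
  refine goodB_of hG (fun A => ?_) (degree_mono h) ?_
  · have := (mad_le_iff G).1 hG.1 A
    have := eIn_mono h A
    omega
  · rintro ⟨K, hK, h1, h2⟩
    exact hG.2.2 ⟨K, hK.trans h, h1, h2⟩

theorem twoPlus_le {V : Type} [Fintype V] {G H : SimpleGraph V}
    (hd : ∀ x, H.degree x ≤ G.degree x) : twoPlusCount H ≤ twoPlusCount G := by
  refine Finset.card_le_card ?_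
  intro x hx
  simp only [Finset.mem_filter, Finset.mem_univ, true_and] at hx ⊢
  exact hx.trans (hd x)

theorem twoPlus_lt {V : Type} [Fintype V] {G H : SimpleGraph V}
    (hd : ∀ x, H.degree x ≤ G.degree x) (u : V) (hu : H.degree u ≤ 1) (hu2 : 2 ≤ G.degree u) :
    twoPlusCount H < twoPlusCount G := by
  refine Finset.card_lt_card ⟨?_, ?_⟩
  · intro x hx
    simp only [Finset.mem_filter, Finset.mem_univ, true_and] at hx ⊢
    exact hx.trans (hd x)
  · intro h
    have := h (x := u) (by simpa using hu2)
    simp at this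
    omega

theorem degree_le {V : Type} [Fintype V] {Δ : ℕ} {G : SimpleGraph V} (hG : MinCexB Δ G) (x : V) :
    G.degree x ≤ Δ := (G.degree_le_maxDegree x).trans hG.1.2.1

/-- Edge removal lemma. -/
theorem edge_lemma {V : Type} [Fintype V] {Δ : ℕ} {G : SimpleGraph V} (hG : MinCexB Δ G)
    {x y : V} (hxy : G.Adj x y)
    (h : ∀ a b, G.Adj x a → a ≠ y → G.Adj y b → b ≠ x → a = b) :
    3 * Δ ≤ ∑ a ∈ (G.neighborFinset x).erase y, G.degree a +
      ∑ a ∈ (G.neighborFinset y).erase x, G.degree a := by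
  by_contra! hlt
  have hle : G.deleteEdges {s(x, y)} ≤ G := SimpleGraph.deleteEdges_le _
  obtain ⟨C, hC⟩ : HasStrongColoring (G.deleteEdges {s(x, y)}) (3 * Δ) := by
    refine hG.2.2 V _ (goodB_mono hG.1 hle) ?_
    rcases (twoPlus_le (degree_mono hle)).lt_or_eq with h' | h'
    · exact Or.inl h'
    · refine Or.inr ⟨h', Set.ncard_lt_ncard ⟨SimpleGraph.edgeSet_mono hle, fun hs => ?_⟩
        (Set.toFinite _)⟩
      have := hs (a := s(x, y)) hxy
      simp at this
  have hval : ValidOn G (G.edgeSet \ {s(x, y)}) C := by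
    intro e he e' he' hc
    refine hC e (by simpa using he) e' (by simpa using he') ⟨hc.1, ?_⟩
    obtain ⟨hne, h1 | ⟨f, hf, ⟨a, ha, haf⟩, ⟨b, hb, hbf⟩⟩⟩ := hc
    · exact Or.inl h1
    by_cases hfe : f = s(x, y)
    · left
      subst hfe
      have key : ∀ e e' : Sym2 V, e ∈ G.edgeSet \ {s(x, y)} → e' ∈ G.edgeSet \ {s(x, y)} →
          x ∈ e → y ∈ e' → ∃ v, v ∈ e ∧ v ∈ e' := by
        intro e e' he he' hx hy
        obtain ⟨p, rfl⟩ := hx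
        obtain ⟨q, rfl⟩ := hy
        have : p = q := h p q he.1 (fun h => he.2 (by rw [h]; rfl)) he'.1
          (fun h => he'.2 (by rw [h]; exact Sym2.eq_swap))
        subst this
        exact ⟨p, by simp, by simp⟩
      rcases Sym2.mem_iff.1 haf with rfl | rfl <;> rcases Sym2.mem_iff.1 hbf with rfl | rfl
      · exact ⟨_, ha, hb⟩
      · exact key e e' he he' ha hb
      · obtain ⟨v, h1, h2⟩ := key e' e he' he hb ha
        exact ⟨v, h2, h1⟩
      · exact ⟨_, ha, hb⟩
    · exact Or.inr ⟨f, by simpa using ⟨hf, hfe⟩, ⟨a, ha, haf⟩, ⟨b, hb, hbf⟩⟩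
  obtain ⟨C', hC'⟩ := valid_extend C hval {s(x, y)} (by
    intro e he
    rw [Finset.mem_singleton] at he
    subst he
    refine ⟨confSet G x y, (card_confSet G x y).trans_lt hlt, fun e' he' hc => ?_⟩
    refine mem_confSet ?_ hc
    rcases he' with h' | h'
    · exact h'.1
    · simp at h'; subst h'; exact hxy)
  refine hG.2.1 ⟨C', fun e he e' he' hc => hC' e ?_ e' ?_ hc⟩
  · by_cases h' : e = s(x, y)
    · right; simp [h']
    · exact Or.inl ⟨he, h'⟩
  · by_cases h' : e' = s(x, y)
    · right; simp [h']
    · exact Or.inl ⟨he', h'⟩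

theorem core_adj {V : Type} [Fintype V] {G : SimpleGraph V} {x y : V} :
    (core G).Adj x y ↔ G.Adj x y ∧ G.degree x ≠ 1 ∧ G.degree y ≠ 1 := by
  unfold core
  rw [SimpleGraph.fromRel_adj]
  constructor
  · rintro ⟨_, h | h⟩
    · exact h
    · exact ⟨h.1.symm, h.2.2, h.2.1⟩
  · intro h
    exact ⟨h.1.ne, Or.inl h⟩

theorem core_le {V : Type} [Fintype V] {G : SimpleGraph V} : core G ≤ G :=
  fun _ _ h => (core_adj.1 h).1

theorem core_nbr_sub {V : Type} [Fintype V] {G : SimpleGraph V} (x : V) :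
    (core G).neighborFinset x ⊆ G.neighborFinset x := by
  intro y hy
  simp only [SimpleGraph.mem_neighborFinset] at hy ⊢
  exact core_le hy

theorem core_nbr_eq {V : Type} [Fintype V] {G : SimpleGraph V} {x : V}
    (h : G.degree x = (core G).degree x) :
    (core G).neighborFinset x = G.neighborFinset x := by
  refine Finset.eq_of_subset_of_card_le (core_nbr_sub x) ?_
  rw [SimpleGraph.card_neighborFinset_eq_degree, SimpleGraph.card_neighborFinset_eq_degree, h]

/-- Pendant lemma. -/
theorem pendant_lemma {V : Type} [Fintype V] {Δ : ℕ} {G : SimpleGraph V} (hG : MinCexB Δ G)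
    {x : V} (h0 : (core G).degree x ≠ 0) (hne : G.degree x ≠ (core G).degree x) :
    3 * Δ + (core G).degree x + 1 ≤
      ∑ a ∈ (core G).neighborFinset x, G.degree a + G.degree x := by
  have hx1 : G.degree x ≠ 1 := by
    obtain ⟨y, hy⟩ := ((core G).degree_pos_iff_exists_adj x).1 (Nat.pos_of_ne_zero h0)
    exact (core_adj.1 hy).2.1
  have hcard : (G.neighborFinset x \ (core G).neighborFinset x).card
      = G.degree x - (core G).degree x := by
    rw [Finset.card_sdiff_of_subset (core_nbr_sub x),
      SimpleGraph.card_neighborFinset_eq_degree, SimpleGraph.card_neighborFinset_eq_degree]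
  have hlt : (core G).degree x < G.degree x :=
    lt_of_le_of_ne (degree_mono core_le x) (Ne.symm hne)
  have hdeg : ∀ y ∈ G.neighborFinset x \ (core G).neighborFinset x, G.degree y = 1 := by
    intro y hy
    simp only [Finset.mem_sdiff, SimpleGraph.mem_neighborFinset, core_adj] at hy
    by_contra h1
    exact hy.2 ⟨hy.1, hx1, h1⟩
  obtain ⟨y, hy⟩ : (G.neighborFinset x \ (core G).neighborFinset x).Nonempty := by
    rw [← Finset.card_pos]; omega
  have hxy : G.Adj x y := by
    have := (Finset.mem_sdiff.1 hy).1
    simpa using this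
  have hyx : (G.neighborFinset y).erase x = ∅ := by
    rw [← Finset.card_eq_zero, Finset.card_erase_of_mem (by simpa using hxy.symm),
      SimpleGraph.card_neighborFinset_eq_degree, hdeg y hy]
  have := edge_lemma hG hxy (by
    intro a b _ _ hb hbx
    have : b ∈ (G.neighborFinset y).erase x := by simp [hbx, hb]
    rw [hyx] at this; simp at this)
  rw [hyx, Finset.sum_empty, add_zero] at this
  have h2 : (G.neighborFinset x).erase y = (core G).neighborFinset x ∪
      (G.neighborFinset x \ (core G).neighborFinset x).erase y := by
    ext t
    have h3 := @core_nbr_sub V _ G x t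
    have h4 := (Finset.mem_sdiff.1 hy).2
    simp only [Finset.mem_erase, Finset.mem_union, Finset.mem_sdiff]
    constructor
    · rintro ⟨h5, h6⟩; tauto
    · rintro (h5 | h5)
      · exact ⟨fun h => h4 (h ▸ h5), h3 h5⟩
      · tauto
  rw [h2, Finset.sum_union (by
    rw [Finset.disjoint_left]
    intro t ht ht'
    simp only [Finset.mem_erase, Finset.mem_sdiff] at ht'
    exact ht'.2.2 ht)] at this
  have h5 : ∑ a ∈ (G.neighborFinset x \ (core G).neighborFinset x).erase y, G.degree a
      = G.degree x - (core G).degree x - 1 := by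
    rw [Finset.sum_congr rfl (fun a ha => hdeg a (Finset.mem_of_mem_erase ha)),
      Finset.sum_const, Finset.card_erase_of_mem hy, hcard]; simp
  omega

theorem sum_le_card {V : Type} [Fintype V] {Δ : ℕ} {G : SimpleGraph V} (hG : MinCexB Δ G)
    (S : Finset V) : ∑ a ∈ S, G.degree a ≤ S.card * Δ := by
  have := Finset.sum_le_card_nsmul S (fun a => G.degree a) Δ (fun a _ => degree_le hG a)
  simpa using this

theorem deg_two {V : Type} [Fintype V] {Δ : ℕ} {G : SimpleGraph V} (hG : MinCexB Δ G)
    {x : V} (h : (core G).degree x = 2) : G.degree x = 2 := by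
  by_contra hne
  have h1 := pendant_lemma hG (x := x) (by omega) (by omega)
  have h2 := sum_le_card hG ((core G).neighborFinset x)
  rw [SimpleGraph.card_neighborFinset_eq_degree, h] at h2
  have := degree_le hG x
  omega

theorem sum_le_erase {V : Type} [Fintype V] {Δ : ℕ} {G : SimpleGraph V} (hG : MinCexB Δ G)
    {S : Finset V} {q : V} (hq : q ∈ S) (hq2 : G.degree q = 2) :
    ∑ a ∈ S, G.degree a ≤ 2 + (S.card - 1) * Δ := by
  rw [← Finset.add_sum_erase S _ hq, hq2]
  have := sum_le_card hG (S.erase q)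
  rw [Finset.card_erase_of_mem hq] at this
  omega

theorem poor_nbr {V : Type} [Fintype V] {Δ : ℕ} {G : SimpleGraph V} (hG : MinCexB Δ G)
    {x : V} (h : Poor3 G x) : ∃ q, (core G).Adj x q ∧ (core G).degree q = 2 := by
  obtain ⟨q, hq⟩ := Finset.card_pos.1 (by rw [h.2]; exact one_pos)
  simp only [Finset.mem_filter, SimpleGraph.mem_neighborFinset] at hq
  exact ⟨q, hq⟩

theorem deg_poor {V : Type} [Fintype V] {Δ : ℕ} {G : SimpleGraph V} (hG : MinCexB Δ G)
    {x : V} (h : Poor3 G x) : G.degree x = 3 := by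
  by_contra hne
  have h1 := pendant_lemma hG (x := x) (by rw [h.1]; omega) (by rw [h.1]; omega)
  obtain ⟨q, hq, hq2⟩ := poor_nbr hG h
  have h2 := sum_le_erase hG (S := (core G).neighborFinset x) (q := q) (by simpa using hq)
    (deg_two hG hq2)
  rw [SimpleGraph.card_neighborFinset_eq_degree, h.1] at h2
  have := degree_le hG x
  have := h.1
  omega

/-- The neighbors of `w` in the core that are neither 2-vertices nor poor 3-vertices. -/
noncomputable def badS {V : Type} [Fintype V] (G : SimpleGraph V) (w : V) : Finset V :=
  ((core G).neighborFinset w).filter (fun x => ¬ ((core G).degree x = 2 ∨ Poor3 G x))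

/-- Common properties of rivals. -/
def Riv {V : Type} [Fintype V] (G : SimpleGraph V) (w : V) : Prop :=
  2 ≤ (core G).degree w ∧ (core G).degree w ≤ 4 ∧ (badS G w).card ≤ 1 ∧ ¬ Poor3 G w

theorem riv_of {V : Type} [Fintype V] {G : SimpleGraph V} {u v w : V}
    (h : VeryPoorWith G u v w) : Riv G w := by
  obtain ⟨hu, huv, huw, hvw, h | ⟨h, h'⟩ | ⟨h, h'⟩⟩ := h
  · refine ⟨by omega, by omega, ?_, fun hp => by have := hp.1; omega⟩
    have : badS G w ⊆ ((core G).neighborFinset w).erase u := by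
      intro t ht
      simp only [badS, Finset.mem_filter] at ht
      refine Finset.mem_erase.2 ⟨?_, ht.1⟩
      rintro rfl; exact ht.2 (Or.inl hu)
    have := Finset.card_le_card this
    rw [Finset.card_erase_of_mem (by simpa using huw.symm),
      SimpleGraph.card_neighborFinset_eq_degree] at this
    omega
  · refine ⟨by omega, by omega, ?_, fun hp => by have := hp.2; omega⟩
    have h1 : badS G w ⊆ ((core G).neighborFinset w).filter (fun x => ¬ (core G).degree x = 2) := by
      intro t ht
      simp only [badS, Finset.mem_filter] at ht ⊢
      tauto
    have h2 := Finset.card_le_card h1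
    have h3 := Finset.card_filter_add_card_filter_not (s := (core G).neighborFinset w)
      (fun x => (core G).degree x = 2)
    rw [SimpleGraph.card_neighborFinset_eq_degree] at h3
    omega
  · exact ⟨by omega, by omega, h', fun hp => by have := hp.1; omega⟩

theorem low_deg {V : Type} [Fintype V] {Δ : ℕ} {G : SimpleGraph V} (hG : MinCexB Δ G)
    {w p : V} (hp : (core G).Adj w p) (hb : p ∉ badS G w) :
    G.degree p = 2 ∨ (G.degree p = 3 ∧ Poor3 G p) := by
  simp only [badS, Finset.mem_filter, SimpleGraph.mem_neighborFinset, not_and, not_not] at hb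
  rcases hb hp with h | h
  · exact Or.inl (deg_two hG h)
  · exact Or.inr ⟨deg_poor hG h, h⟩

theorem sum_low {V : Type} [Fintype V] {Δ : ℕ} (hΔ : 7 ≤ Δ) {G : SimpleGraph V}
    (hG : MinCexB Δ G) {w : V} (S : Finset V) (hS : S ⊆ (core G).neighborFinset w) :
    ∑ a ∈ S, G.degree a ≤ 3 * S.card + (Δ - 3) * (S ∩ badS G w).card := by
  have : ∀ a ∈ S, G.degree a ≤ 3 + (if a ∈ badS G w then Δ - 3 else 0) := by
    intro a ha
    have h1 := degree_le hG a
    split_ifs with h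
    · omega
    · have := low_deg hG (w := w) (p := a) (by simpa using hS ha) h
      omega
  refine (Finset.sum_le_sum this).trans (le_of_eq ?_)
  rw [Finset.sum_add_distrib, Finset.sum_const, ← Finset.sum_filter, Finset.sum_const,
    Finset.filter_mem_eq_inter]
  simp [mul_comm]

theorem sum_low_riv {V : Type} [Fintype V] {Δ : ℕ} (hΔ : 7 ≤ Δ) {G : SimpleGraph V}
    (hG : MinCexB Δ G) {w : V} (hw : Riv G w) (S : Finset V)
    (hS : S ⊆ (core G).neighborFinset w) :
    ∑ a ∈ S, G.degree a ≤ 3 * S.card + (Δ - 3) := by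
  refine (sum_low hΔ hG S hS).trans ?_
  have h1 : (S ∩ badS G w).card ≤ 1 :=
    (Finset.card_le_card Finset.inter_subset_right).trans hw.2.2.1
  have := Nat.mul_le_mul_left (Δ - 3) h1
  omega

theorem deg_riv {V : Type} [Fintype V] {Δ : ℕ} (hΔ : 7 ≤ Δ) {G : SimpleGraph V}
    (hG : MinCexB Δ G) {w : V} (hw : Riv G w) : G.degree w = (core G).degree w := by
  by_contra hne
  have h1 := pendant_lemma hG (x := w) (by have := hw.1; omega) hne
  have h2 := sum_low_riv hΔ hG hw _ (Finset.Subset.refl _)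
  rw [SimpleGraph.card_neighborFinset_eq_degree] at h2
  have := degree_le hG w
  have := hw.2.1
  omega

theorem count_B {V : Type} [Fintype V] {Δ : ℕ} (hΔ : 7 ≤ Δ) {G : SimpleGraph V}
    (hG : MinCexB Δ G) {w u : V} (hw : Riv G w) (hwu : (core G).Adj w u)
    (hu : (core G).degree u = 2) : (confSet G u w).card < 3 * Δ := by
  refine (card_confSet G u w).trans_lt ?_
  have h1 := sum_le_card hG ((G.neighborFinset u).erase w)
  rw [Finset.card_erase_of_mem (by simpa using (core_le hwu).symm),
    SimpleGraph.card_neighborFinset_eq_degree, deg_two hG hu] at h1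
  have h2 := sum_low_riv hΔ hG hw ((G.neighborFinset w).erase u) (by
    rw [core_nbr_eq (deg_riv hΔ hG hw)]; exact Finset.erase_subset _ _)
  rw [Finset.card_erase_of_mem (by simpa using core_le hwu),
    SimpleGraph.card_neighborFinset_eq_degree, deg_riv hΔ hG hw] at h2
  have := hw.2.1
  omega

theorem count_A {V : Type} [Fintype V] {Δ : ℕ} (hΔ : 7 ≤ Δ) {G : SimpleGraph V}
    (hG : MinCexB Δ G) {w u p : V} (hw : Riv G w) (hwu : (core G).Adj w u)
    (hu : (core G).degree u = 2) (hwp : (core G).Adj w p) (hp : p ∉ badS G w) (hpu : p ≠ u) :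
    ((confSet G w p).erase s(u, w)).card < 3 * Δ := by
  have hmem : s(u, w) ∈ confSet G w p :=
    mem_confSet_of_adj (core_le hwu) hpu.symm (core_le hwu).symm (by simp)
  rw [Finset.card_erase_of_mem hmem]
  have h0 := card_confSet G w p
  have hdw := deg_riv hΔ hG hw
  have hu' : u ∈ (G.neighborFinset w).erase p := by simp [hpu.symm, core_le hwu]
  have h1 := Finset.add_sum_erase _ (fun a => G.degree a) hu'
  have h2 := sum_low_riv hΔ hG hw (((G.neighborFinset w).erase p).erase u) (by
    rw [core_nbr_eq hdw]
    exact (Finset.erase_subset _ _).trans (Finset.erase_subset _ _))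
  rw [Finset.card_erase_of_mem hu', Finset.card_erase_of_mem (by simpa using core_le hwp),
    SimpleGraph.card_neighborFinset_eq_degree, hdw] at h2
  simp only [deg_two hG hu] at h1
  have hw4 := hw.2.1
  have hpw : w ∈ G.neighborFinset p := by simpa using (core_le hwp).symm
  have hc : ((G.neighborFinset p).erase w).card = G.degree p - 1 := by
    rw [Finset.card_erase_of_mem hpw, SimpleGraph.card_neighborFinset_eq_degree]
  rcases low_deg hG hwp hp with h | ⟨h, h'⟩
  · have h3 := sum_le_card hG ((G.neighborFinset p).erase w)
    rw [hc, h] at h3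
    omega
  · obtain ⟨q, hq, hq2⟩ := poor_nbr hG h'
    by_cases hqw : q = w
    · subst hqw
      have h3 := sum_le_card hG ((G.neighborFinset p).erase q)
      rw [hc, h] at h3
      have h4 : (((G.neighborFinset q).erase p).erase u).card = 0 := by
        rw [Finset.card_erase_of_mem hu', Finset.card_erase_of_mem (by simpa using core_le hwp),
          SimpleGraph.card_neighborFinset_eq_degree, hdw, hq2]
      rw [Finset.card_eq_zero] at h4
      rw [h4, Finset.sum_empty] at h1
      omega
    · have h3 := sum_le_erase hG (S := (G.neighborFinset p).erase w) (q := q)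
        (by simp [hqw, core_le hq]) (deg_two hG hq2)
      rw [hc, h] at h3
      omega

theorem count_E {V : Type} [Fintype V] {Δ : ℕ} (hΔ : 7 ≤ Δ) {G : SimpleGraph V}
    (hG : MinCexB Δ G) {w w' : V} (hw : Riv G w) (hw' : Riv G w')
    (h : w' ∈ badS G w) (h' : w ∈ badS G w') : (confSet G w w').card < 3 * Δ := by
  have key : ∀ w w' : V, Riv G w → w' ∈ badS G w →
      ∑ a ∈ (G.neighborFinset w).erase w', G.degree a ≤ 9 := by
    intro w w' hw h
    have hdw := deg_riv hΔ hG hw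
    have hmem : w' ∈ G.neighborFinset w := by
      rw [← core_nbr_eq hdw]; exact (Finset.mem_filter.1 h).1
    have h2 := sum_low hΔ hG (w := w) ((G.neighborFinset w).erase w') (by
      rw [core_nbr_eq hdw]; exact Finset.erase_subset _ _)
    have h3 : (G.neighborFinset w).erase w' ∩ badS G w = ∅ := by
      ext t
      simp only [Finset.mem_inter, Finset.mem_erase, Finset.notMem_empty, iff_false, not_and]
      rintro ⟨ht, _⟩ ht'
      exact ht (Finset.card_le_one.1 hw.2.2.1 _ ht' _ h)
    rw [h3, Finset.card_erase_of_mem hmem, SimpleGraph.card_neighborFinset_eq_degree, hdw] at h2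
    have := hw.2.1
    simp at h2
    omega
  have h0 := card_confSet G w w'
  have h1 := key w w' hw h
  have h2 := key w' w hw' h'
  omega

/-- The configuration (non-degenerate). -/
structure Cfg {V : Type} [Fintype V] (G : SimpleGraph V) (v u₁ w₁ u₂ w₂ : V) : Prop where
  hu : u₁ ≠ u₂
  n1 : ∀ x, G.Adj u₁ x ↔ x = v ∨ x = w₁
  n2 : ∀ x, G.Adj u₂ x ↔ x = v ∨ x = w₂
  hw1 : v ≠ w₁
  hw2 : v ≠ w₂
  c1 : (core G).Adj w₁ u₁
  c2 : (core G).Adj w₂ u₂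
  d1 : (core G).degree u₁ = 2
  d2 : (core G).degree u₂ = 2
  r1 : Riv G w₁
  r2 : Riv G w₂
  x1 : w₁ ≠ u₂
  x2 : w₂ ≠ u₁

theorem Cfg.symm {V : Type} [Fintype V] {G : SimpleGraph V} {v u₁ w₁ u₂ w₂ : V}
    (h : Cfg G v u₁ w₁ u₂ w₂) : Cfg G v u₂ w₂ u₁ w₁ :=
  ⟨h.hu.symm, h.n2, h.n1, h.hw2, h.hw1, h.c2, h.c1, h.d2, h.d1, h.r2, h.r1, h.x2, h.x1⟩

/-- The edges avoiding `u₁` and `u₂`. -/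
def restE {V : Type} (G : SimpleGraph V) (u₁ u₂ : V) : Set (Sym2 V) :=
  {e | e ∈ G.edgeSet ∧ u₁ ∉ e ∧ u₂ ∉ e}

/-- A partial coloring together with two colors free at `v`. -/
structure PreCol {V : Type} (G : SimpleGraph V) (v u₁ u₂ : V) {k : ℕ}
    (C : Sym2 V → Fin k) (α β : Fin k) : Prop where
  val : ValidOn G (restE G u₁ u₂) C
  free : ∀ e ∈ restE G u₁ u₂, ∀ x ∈ e, (x = v ∨ G.Adj v x) → C e ≠ α ∧ C e ≠ β
  ne : α ≠ β

theorem PreCol.swap {V : Type} {G : SimpleGraph V} {v u₁ u₂ : V} {k : ℕ}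
    {C : Sym2 V → Fin k} {α β : Fin k} (h : PreCol G v u₁ u₂ C α β) :
    PreCol G v u₁ u₂ C β α :=
  ⟨h.val, fun e he x hx hv => (h.free e he x hx hv).symm, h.ne.symm⟩

theorem PreCol.swapu {V : Type} {G : SimpleGraph V} {v u₁ u₂ : V} {k : ℕ}
    {C : Sym2 V → Fin k} {α β : Fin k} (h : PreCol G v u₁ u₂ C α β) :
    PreCol G v u₂ u₁ C α β := by
  have : restE G u₂ u₁ = restE G u₁ u₂ := by
    ext e; simp only [restE, Set.mem_ofPred_eq]; tauto
  exact ⟨by rw [this]; exact h.val, by rw [this]; exact h.free, h.ne⟩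

/-- Low edges at `w`. -/
def lowE {V : Type} [Fintype V] (G : SimpleGraph V) (w : V) : Set (Sym2 V) :=
  {e | ∃ p, G.Adj w p ∧ p ∉ badS G w ∧ e = s(w, p)}

theorem finish {V : Type} [Fintype V] {Δ : ℕ} (hΔ : 7 ≤ Δ) {G : SimpleGraph V}
    (hG : MinCexB Δ G) {v u₁ w₁ u₂ w₂ : V} (h : Cfg G v u₁ w₁ u₂ w₂)
    {C : Sym2 V → Fin (3 * Δ)} {α β : Fin (3 * Δ)} (hC : PreCol G v u₁ u₂ C α β)
    (hα : ∀ z ∈ badS G w₁, C s(w₁, z) ≠ α) (hβ : ∀ z ∈ badS G w₂, C s(w₂, z) ≠ β) : False := by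
  have hb1 : u₁ ∉ badS G w₁ := fun hb => (Finset.mem_filter.1 hb).2 (Or.inl h.d1)
  have hb2 : u₂ ∉ badS G w₂ := fun hb => (Finset.mem_filter.1 hb).2 (Or.inl h.d2)
  have hvu1 : G.Adj v u₁ := ((h.n1 v).2 (Or.inl rfl)).symm
  have hvu2 : G.Adj v u₂ := ((h.n2 v).2 (Or.inl rfl)).symm
  set C0 : Sym2 V → Fin (3 * Δ) :=
    Function.update (Function.update C s(v, u₁) α) s(v, u₂) β with hC0
  have hne12 : s(v, u₁) ≠ s(v, u₂) := by
    intro he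
    exact h.hu (Sym2.congr_right.1 he)
  set E0 : Set (Sym2 V) := {e | e ∈ G.edgeSet ∧ e ∉ lowE G w₁ ∧ e ∉ lowE G w₂} with hE0
  -- generic facts used for both sides
  have side : ∀ (u w u' : V) (γ : Fin (3 * Δ)), (∀ x, G.Adj u x ↔ x = v ∨ x = w) →
      (∀ e ∈ restE G u₁ u₂, ∀ x ∈ e, (x = v ∨ G.Adj v x) → C e ≠ γ) →
      (∀ z ∈ badS G w, C s(w, z) ≠ γ) → ∀ e ∈ restE G u₁ u₂, e ∉ lowE G w → u ∉ e →
      Conflict G s(v, u) e → C e ≠ γ := by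
    intro u w u' γ hn hf hbad e he hlow hue hc
    have hw : w ∈ e → C e ≠ γ := by
      rintro ⟨z, rfl⟩
      by_cases hz : z ∈ badS G w
      · exact hbad z hz
      · exact absurd ⟨z, he.1, hz, rfl⟩ hlow
    obtain ⟨hne, ⟨t, ht, ht'⟩ | ⟨f, hf', ⟨t, ht, htf⟩, ⟨x, hx, hxf⟩⟩⟩ := hc
    · rcases Sym2.mem_iff.1 ht with rfl | rfl
      · exact hf e he t ht' (Or.inl rfl)
      · exact absurd ht' hue
    · rcases Sym2.mem_iff.1 ht with rfl | rfl
      · by_cases hxt : x = t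
        · exact hf e he x hx (Or.inl hxt)
        · have : f = s(t, x) := ((Sym2.mem_and_mem_iff (Ne.symm hxt)).1 ⟨htf, hxf⟩)
          subst this
          exact hf e he x hx (Or.inr hf')
      · by_cases hxt : x = t
        · subst hxt; exact absurd hx hue
        · have : f = s(t, x) := ((Sym2.mem_and_mem_iff (Ne.symm hxt)).1 ⟨htf, hxf⟩)
          subst this
          rcases (hn x).1 hf' with rfl | rfl
          · exact hf e he x hx (Or.inl rfl)
          · exact hw hx
  have cls : ∀ e ∈ E0, e = s(v, u₁) ∨ e = s(v, u₂) ∨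
      (e ∈ restE G u₁ u₂ ∧ e ≠ s(v, u₁) ∧ e ≠ s(v, u₂)) := by
    intro e he
    by_cases h1 : u₁ ∈ e
    · obtain ⟨x, rfl⟩ := h1
      rcases (h.n1 x).1 he.1 with rfl | rfl
      · exact Or.inl Sym2.eq_swap
      · exact absurd ⟨u₁, core_le h.c1, hb1, Sym2.eq_swap⟩ he.2.1
    by_cases h2 : u₂ ∈ e
    · obtain ⟨x, rfl⟩ := h2
      rcases (h.n2 x).1 he.1 with rfl | rfl
      · exact Or.inr (Or.inl Sym2.eq_swap)
      · exact absurd ⟨u₂, core_le h.c2, hb2, Sym2.eq_swap⟩ he.2.2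
    refine Or.inr (Or.inr ⟨⟨he.1, h1, h2⟩, ?_, ?_⟩)
    · rintro rfl; simp at h1
    · rintro rfl; simp at h2
  have v1 : C0 s(v, u₁) = α := by
    rw [hC0, Function.update_of_ne hne12, Function.update_self]
  have v2 : C0 s(v, u₂) = β := by rw [hC0, Function.update_self]
  have v3 : ∀ e, e ≠ s(v, u₁) → e ≠ s(v, u₂) → C0 e = C e := by
    intro e h1 h2
    rw [hC0, Function.update_of_ne h2, Function.update_of_ne h1]
  have S1 := fun e he hl hu hc => side u₁ w₁ u₂ α h.n1
    (fun e he x hx hv => (hC.free e he x hx hv).1) hα e he hl hu hc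
  have S2 := fun e he hl hu hc => side u₂ w₂ u₁ β h.n2
    (fun e he x hx hv => (hC.free e he x hx hv).2) hβ e he hl hu hc
  have hval0 : ValidOn G E0 C0 := by
    intro e he e' he' hc
    rcases cls e he with rfl | rfl | ⟨h1, h2, h3⟩ <;>
      rcases cls e' he' with rfl | rfl | ⟨h1', h2', h3'⟩
    · exact absurd rfl hc.1
    · rw [v1, v2]; exact hC.ne
    · rw [v1, v3 _ h2' h3']; exact (S1 e' h1' he'.2.1 h1'.2.1 hc).symm
    · rw [v1, v2]; exact hC.ne.symm
    · exact absurd rfl hc.1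
    · rw [v2, v3 _ h2' h3']; exact (S2 e' h1' he'.2.2 h1'.2.2 hc).symm
    · rw [v1, v3 _ h2 h3]; exact S1 e h1 he.2.1 h1.2.1 (conflict_symm hc)
    · rw [v2, v3 _ h2 h3]; exact S2 e h1 he.2.2 h1.2.2 (conflict_symm hc)
    · rw [v3 _ h2 h3, v3 _ h2' h3']; exact hC.val e h1 e' h1' hc
  set L1 : Finset (Sym2 V) := Finset.univ.filter
    (fun e => (e ∈ lowE G w₁ ∨ e ∈ lowE G w₂) ∧ e ≠ s(u₁, w₁) ∧ e ≠ s(u₂, w₂)) with hL1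
  have lowG : ∀ w, lowE G w ⊆ G.edgeSet := by
    rintro w e ⟨p, hp, _, rfl⟩; exact hp
  have hsub : ∀ e ∈ E0 ∪ (L1 : Set (Sym2 V)),
      e ∈ G.edgeSet ∧ e ≠ s(u₁, w₁) ∧ e ≠ s(u₂, w₂) := by
    rintro e (he | he)
    · refine ⟨he.1, ?_, ?_⟩
      · rintro rfl; exact he.2.1 ⟨u₁, core_le h.c1, hb1, Sym2.eq_swap⟩
      · rintro rfl; exact he.2.2 ⟨u₂, core_le h.c2, hb2, Sym2.eq_swap⟩
    · simp only [hL1, Finset.coe_filter, Finset.mem_univ, true_and, Set.mem_ofPred_eq] at he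
      refine ⟨?_, he.2⟩
      rcases he.1 with h' | h'
      · exact lowG _ h'
      · exact lowG _ h'
  obtain ⟨C1, hC1⟩ := valid_extend C0 hval0 L1 (by
    intro e he
    simp only [hL1, Finset.mem_filter, Finset.mem_univ, true_and] at he
    obtain ⟨⟨p, hp, hpb, rfl⟩ | ⟨p, hp, hpb, rfl⟩, hne1, hne2⟩ := he
    · refine ⟨(confSet G w₁ p).erase s(u₁, w₁), count_A hΔ hG h.r1 h.c1 h.d1 ?_ hpb ?_, ?_⟩
      · have : p ∈ (core G).neighborFinset w₁ := by
          rw [core_nbr_eq (deg_riv hΔ hG h.r1)]; simpa using hp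
        simpa using this
      · rintro rfl; exact hne1 Sym2.eq_swap
      · intro e' he' hc
        exact Finset.mem_erase.2 ⟨(hsub e' he').2.1, mem_confSet (hsub e' he').1 hc⟩
    · refine ⟨(confSet G w₂ p).erase s(u₂, w₂), count_A hΔ hG h.r2 h.c2 h.d2 ?_ hpb ?_, ?_⟩
      · have : p ∈ (core G).neighborFinset w₂ := by
          rw [core_nbr_eq (deg_riv hΔ hG h.r2)]; simpa using hp
        simpa using this
      · rintro rfl; exact hne2 Sym2.eq_swap
      · intro e' he' hc
        exact Finset.mem_erase.2 ⟨(hsub e' he').2.2, mem_confSet (hsub e' he').1 hc⟩)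
  have e1 : s(u₁, w₁) ∈ G.edgeSet := (core_le h.c1).symm
  have e2 : s(u₂, w₂) ∈ G.edgeSet := (core_le h.c2).symm
  have hsub2 : ∀ e ∈ E0 ∪ (L1 : Set (Sym2 V)) ∪
      (({s(u₁, w₁), s(u₂, w₂)} : Finset (Sym2 V)) : Set (Sym2 V)), e ∈ G.edgeSet := by
    rintro e (he | he)
    · exact (hsub e he).1
    · simp at he
      rcases he with rfl | rfl
      · exact e1
      · exact e2
  obtain ⟨C2, hC2⟩ := valid_extend C1 hC1 {s(u₁, w₁), s(u₂, w₂)} (by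
    intro e he
    simp only [Finset.mem_insert, Finset.mem_singleton] at he
    rcases he with rfl | rfl
    · exact ⟨confSet G u₁ w₁, count_B hΔ hG h.r1 h.c1 h.d1,
        fun e' he' hc => mem_confSet (hsub2 e' he') hc⟩
    · exact ⟨confSet G u₂ w₂, count_B hΔ hG h.r2 h.c2 h.d2,
        fun e' he' hc => mem_confSet (hsub2 e' he') hc⟩)
  have hall : ∀ e ∈ G.edgeSet, e ∈ E0 ∪ (L1 : Set (Sym2 V)) ∪
      (({s(u₁, w₁), s(u₂, w₂)} : Finset (Sym2 V)) : Set (Sym2 V)) := by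
    intro e he
    by_cases h1 : e = s(u₁, w₁)
    · right; simp [h1]
    by_cases h2 : e = s(u₂, w₂)
    · right; simp [h2]
    left
    by_cases h3 : e ∈ lowE G w₁ ∨ e ∈ lowE G w₂
    · right; simp [hL1, h1, h2, h3]
    · rw [not_or] at h3
      exact Or.inl ⟨he, h3⟩
  exact hG.2.1 ⟨C2, fun e he e' he' hc => hC2 e (hall e he) e' (hall e' he') hc⟩

theorem bad_ne_u {V : Type} [Fintype V] {G : SimpleGraph V} {w z u : V}
    (hz : z ∈ badS G w) (hu : (core G).degree u = 2) : z ≠ u := by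
  rintro rfl
  exact (Finset.mem_filter.1 hz).2 (Or.inl hu)

theorem bad_adj {V : Type} [Fintype V] {G : SimpleGraph V} {w z : V}
    (hz : z ∈ badS G w) : G.Adj w z := by
  have := (Finset.mem_filter.1 hz).1
  exact core_le (by simpa using this)

theorem Cfg.ne_w1 {V : Type} [Fintype V] {G : SimpleGraph V} {v u₁ w₁ u₂ w₂ : V}
    (h : Cfg G v u₁ w₁ u₂ w₂) : w₁ ≠ u₁ := h.c1.ne

theorem bad_rest {V : Type} [Fintype V] {G : SimpleGraph V} {v u₁ w₁ u₂ w₂ : V}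
    (h : Cfg G v u₁ w₁ u₂ w₂) {z : V} (hz : z ∈ badS G w₁) : s(w₁, z) ∈ restE G u₁ u₂ := by
  refine ⟨bad_adj hz, ?_, ?_⟩
  · rw [Sym2.mem_iff, not_or]
    exact ⟨h.ne_w1.symm, (bad_ne_u hz h.d1).symm⟩
  · rw [Sym2.mem_iff, not_or]
    exact ⟨h.x1.symm, (bad_ne_u hz h.d2).symm⟩

theorem restE_comm {V : Type} (G : SimpleGraph V) (u₁ u₂ : V) :
    restE G u₂ u₁ = restE G u₁ u₂ := by
  ext e; simp only [restE, Set.mem_ofPred_eq]; tauto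

theorem finish2 {V : Type} [Fintype V] {Δ : ℕ} (hΔ : 7 ≤ Δ) {G : SimpleGraph V}
    (hG : MinCexB Δ G) {v u₁ w₁ u₂ w₂ : V} (h : Cfg G v u₁ w₁ u₂ w₂)
    {C : Sym2 V → Fin (3 * Δ)} {α β : Fin (3 * Δ)} (hC : PreCol G v u₁ u₂ C α β)
    (hcom : ∀ z₁ ∈ badS G w₁, ∀ z₂ ∈ badS G w₂, C s(w₁, z₁) = C s(w₂, z₂) →
      C s(w₁, z₁) ≠ α ∧ C s(w₁, z₁) ≠ β) : False := by
  have one1 := Finset.card_le_one.1 h.r1.2.2.1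
  have one2 := Finset.card_le_one.1 h.r2.2.2.1
  by_cases ha : ∀ z ∈ badS G w₁, C s(w₁, z) ≠ α
  · by_cases hb : ∀ z ∈ badS G w₂, C s(w₂, z) ≠ β
    · exact finish hΔ hG h hC ha hb
    · push Not at hb
      obtain ⟨z, hz, hzb⟩ := hb
      refine finish hΔ hG h hC.swap ?_ ?_
      · intro z' hz' h'
        exact (hcom z' hz' z hz (h'.trans hzb.symm)).2 h'
      · intro z' hz' h'
        rw [one2 z' hz' z hz, hzb] at h'
        exact hC.ne h'.symm
  · push Not at ha
    obtain ⟨z, hz, hzb⟩ := ha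
    refine finish hΔ hG h hC.swap ?_ ?_
    · intro z' hz' h'
      rw [one1 z' hz' z hz, hzb] at h'
      exact hC.ne h'
    · intro z' hz' h'
      exact (hcom z hz z' hz' (hzb.trans h'.symm)).1 hzb

theorem finish_exotic {V : Type} [Fintype V] {Δ : ℕ} (hΔ : 7 ≤ Δ) {G : SimpleGraph V}
    (hG : MinCexB Δ G) {v u₁ w₁ u₂ w₂ : V} (h : Cfg G v u₁ w₁ u₂ w₂)
    {C : Sym2 V → Fin (3 * Δ)} {α β : Fin (3 * Δ)} (hC : PreCol G v u₁ u₂ C α β)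
    (h1 : w₂ ∈ badS G w₁) (h2 : w₁ ∈ badS G w₂) : False := by
  have hvu1 : G.Adj v u₁ := ((h.n1 v).2 (Or.inl rfl)).symm
  have hvu2 : G.Adj v u₂ := ((h.n2 v).2 (Or.inl rfl)).symm
  have hne12 : s(v, u₁) ≠ s(v, u₂) := fun he => h.hu (Sym2.congr_right.1 he)
  set C0 : Sym2 V → Fin (3 * Δ) :=
    Function.update (Function.update C s(v, u₁) α) s(v, u₂) β with hC0
  have v1 : C0 s(v, u₁) = α := by
    rw [hC0, Function.update_of_ne hne12, Function.update_self]
  have v2 : C0 s(v, u₂) = β := by rw [hC0, Function.update_self]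
  have v3 : ∀ e ∈ restE G u₁ u₂, C0 e = C e := by
    intro e he
    rw [hC0, Function.update_of_ne, Function.update_of_ne]
    · rintro rfl; exact he.2.1 (by simp)
    · rintro rfl; exact he.2.2 (by simp)
  obtain ⟨c, hc⟩ := exists_color C0 _ (count_E hΔ hG h.r1 h.r2 h1 h2)
  have cα : α ≠ c := by
    rw [← v1]
    exact hc _ (mem_confSet_of_adj (core_le h.c1) h.x2.symm hvu1 (by simp))
  have cβ : β ≠ c := by
    rw [← v2]
    refine hc _ ?_
    rw [confSet_symm]
    exact mem_confSet_of_adj (core_le h.c2) h.x1.symm hvu2 (by simp)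
  have hrest := bad_rest h h1
  have hins : insert s(w₁, w₂) (restE G u₁ u₂) = restE G u₁ u₂ := Set.insert_eq_of_mem hrest
  have hC' : PreCol G v u₁ u₂ (Function.update C s(w₁, w₂) c) α β := by
    refine ⟨?_, ?_, hC.ne⟩
    · have := valid_update hC.val s(w₁, w₂) c (by
        intro e' he' hcf
        rw [← v3 e' he']
        exact hc e' (mem_confSet he'.1 hcf))
      rwa [hins] at this
    · intro e he x hx hv
      by_cases hee : e = s(w₁, w₂)
      · rw [hee, Function.update_self]
        exact ⟨cα.symm, cβ.symm⟩
      · rw [Function.update_of_ne hee]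
        exact hC.free e he x hx hv
  refine finish hΔ hG h hC' ?_ ?_
  · intro z hz
    rw [Finset.card_le_one.1 h.r1.2.2.1 z hz w₂ h1, Function.update_self]
    exact cα.symm
  · intro z hz
    rw [Finset.card_le_one.1 h.r2.2.2.1 z hz w₁ h2, Sym2.eq_swap, Function.update_self]
    exact cβ.symm

theorem valid_of_H {V : Type} {k : ℕ} {G H : SimpleGraph V} {u₁ u₂ : V}
    (h1 : ∀ x y, x ≠ u₁ → x ≠ u₂ → y ≠ u₁ → y ≠ u₂ → G.Adj x y → H.Adj x y)
    {C : Sym2 V → Fin k} (hC : IsStrongColoring H C) :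
    restE G u₁ u₂ ⊆ H.edgeSet ∧ ValidOn G (restE G u₁ u₂) C := by
  have hsub : restE G u₁ u₂ ⊆ H.edgeSet := by
    intro e he
    induction e with
    | h x y =>
      obtain ⟨ha, hb, hc⟩ := he
      rw [Sym2.mem_iff, not_or] at hb hc
      exact h1 x y (Ne.symm hb.1) (Ne.symm hc.1) (Ne.symm hb.2) (Ne.symm hc.2) ha
  refine ⟨hsub, fun e he e' he' hc => hC e (hsub he) e' (hsub he') ⟨hc.1, ?_⟩⟩
  obtain ⟨hne, hs | ⟨f, hf, ⟨a, ha, haf⟩, ⟨b, hb, hbf⟩⟩⟩ := hc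
  · exact Or.inl hs
  by_cases hab : a = b
  · subst hab; exact Or.inl ⟨a, ha, hb⟩
  right
  refine ⟨f, hsub ?_, ⟨a, ha, haf⟩, ⟨b, hb, hbf⟩⟩
  have : f = s(a, b) := (Sym2.mem_and_mem_iff hab).1 ⟨haf, hbf⟩
  subst this
  refine ⟨hf, ?_, ?_⟩
  · rw [Sym2.mem_iff, not_or]
    exact ⟨fun h => he.2.1 (h ▸ ha), fun h => he'.2.1 (h ▸ hb)⟩
  · rw [Sym2.mem_iff, not_or]
    exact ⟨fun h => he.2.2 (h ▸ ha), fun h => he'.2.2 (h ▸ hb)⟩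

theorem free_of_H {V : Type} {k : ℕ} {H : SimpleGraph V} {C : Sym2 V → Fin k}
    (hC : IsStrongColoring H C) {v t x : V} (hvt : H.Adj v t) {e : Sym2 V}
    (he : e ∈ H.edgeSet) (hne : e ≠ s(v, t)) (hx : x ∈ e) (hv : x = v ∨ H.Adj v x) :
    C e ≠ C s(v, t) := by
  refine hC e he _ hvt ⟨hne, ?_⟩
  rcases hv with rfl | hv
  · exact Or.inl ⟨x, hx, by simp⟩
  · exact Or.inr ⟨s(v, x), hv, ⟨x, hx, by simp⟩, ⟨v, by simp, by simp⟩⟩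

theorem precol_of_H {V : Type} [Fintype V] {k : ℕ} {G H : SimpleGraph V} {v u₁ w₁ u₂ w₂ : V}
    (h : Cfg G v u₁ w₁ u₂ w₂)
    (h1 : ∀ x y, x ≠ u₁ → x ≠ u₂ → y ≠ u₁ → y ≠ u₂ → G.Adj x y → H.Adj x y)
    {C : Sym2 V → Fin k} (hC : IsStrongColoring H C) {s t : V} (hs : H.Adj v s) (ht : H.Adj v t)
    (hst : s ≠ t) (hs' : s(v, s) ∉ restE G u₁ u₂) (ht' : s(v, t) ∉ restE G u₁ u₂) :
    PreCol G v u₁ u₂ C (C s(v, s)) (C s(v, t)) := by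
  obtain ⟨hsub, hval⟩ := valid_of_H h1 hC
  have hv1 : v ≠ u₁ := ((h.n1 v).2 (Or.inl rfl)).ne'
  have hv2 : v ≠ u₂ := ((h.n2 v).2 (Or.inl rfl)).ne'
  refine ⟨hval, ?_, ?_⟩
  · intro e he x hx hv
    have hv' : x = v ∨ H.Adj v x := by
      rcases hv with hv | hv
      · exact Or.inl hv
      · refine Or.inr (h1 v x hv1 hv2 ?_ ?_ hv)
        · rintro rfl; exact he.2.1 hx
        · rintro rfl; exact he.2.2 hx
    exact ⟨free_of_H hC hs (hsub he) (fun h => hs' (h ▸ he)) hx hv',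
      free_of_H hC ht (hsub he) (fun h => ht' (h ▸ he)) hx hv'⟩
  · exact free_of_H hC ht hs (fun h => hst (Sym2.congr_right.1 h)) (x := v) (by simp) (Or.inl rfl)

theorem deg_le_one {V : Type} [Fintype V] {H : SimpleGraph V} {u v : V}
    (h : ∀ x, H.Adj u x → x = v) : H.degree u ≤ 1 := by
  rw [← SimpleGraph.card_neighborFinset_eq_degree, Finset.card_le_one]
  intro a ha b hb
  rw [h a (by simpa using ha), h b (by simpa using hb)]

theorem u1_not_rest {V : Type} {G : SimpleGraph V} {v u₁ u₂ : V} :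
    s(v, u₁) ∉ restE G u₁ u₂ := fun h => h.2.1 (by simp)

theorem u2_not_rest {V : Type} {G : SimpleGraph V} {v u₁ u₂ : V} :
    s(v, u₂) ∉ restE G u₁ u₂ := fun h => h.2.2 (by simp)

theorem exists_H0 {V : Type} [Fintype V] {Δ : ℕ} {G : SimpleGraph V}
    (hG : MinCexB Δ G) {v u₁ w₁ u₂ w₂ : V} (h : Cfg G v u₁ w₁ u₂ w₂) :
    ∃ (C : Sym2 V → Fin (3 * Δ)) (α β : Fin (3 * Δ)), PreCol G v u₁ u₂ C α β := by
  have hv1 : v ≠ u₁ := ((h.n1 v).2 (Or.inl rfl)).ne'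
  have hv2 : v ≠ u₂ := ((h.n2 v).2 (Or.inl rfl)).ne'
  set H := G.deleteEdges {s(u₁, w₁), s(u₂, w₂)} with hH
  have hle : H ≤ G := SimpleGraph.deleteEdges_le _
  have hadj : ∀ x y, H.Adj x y ↔ G.Adj x y ∧ s(x, y) ≠ s(u₁, w₁) ∧ s(x, y) ≠ s(u₂, w₂) := by
    intro x y; rw [hH, SimpleGraph.deleteEdges_adj]; simp
  obtain ⟨C, hC⟩ := hG.2.2 V H (goodB_mono hG.1 hle) (Or.inl (twoPlus_lt (degree_mono hle) u₁
    (deg_le_one (v := v) (by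
      intro x hx
      rw [hadj] at hx
      rcases (h.n1 x).1 hx.1 with h' | h'
      · exact h'
      · subst h'; exact absurd rfl hx.2.1)) (by rw [deg_two hG h.d1])))
  refine ⟨C, _, _, precol_of_H h ?_ hC (s := u₁) (t := u₂) ?_ ?_ h.hu u1_not_rest u2_not_rest⟩
  · intro x y hx1 hx2 hy1 hy2 hxy
    rw [hadj]
    refine ⟨hxy, ?_, ?_⟩
    · intro he; rw [Sym2.eq_iff] at he; tauto
    · intro he; rw [Sym2.eq_iff] at he; tauto
  · rw [hadj]
    refine ⟨((h.n1 v).2 (Or.inl rfl)).symm, ?_, ?_⟩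
    · intro he; rw [Sym2.eq_iff] at he
      have := h.hw1; tauto
    · intro he; rw [Sym2.eq_iff] at he
      have := h.x2; have := h.hu; tauto
  · rw [hadj]
    refine ⟨((h.n2 v).2 (Or.inl rfl)).symm, ?_, ?_⟩
    · intro he; rw [Sym2.eq_iff] at he
      have := h.x1; have := h.hu; tauto
    · intro he; rw [Sym2.eq_iff] at he
      have := h.hw2; tauto

theorem good_H {V : Type} [Fintype V] {Δ : ℕ} (hΔ : 7 ≤ Δ) {G H : SimpleGraph V}
    (hG : MinCexB Δ G) {v u₁ w₁ u₂ w₂ : V} (h : Cfg G v u₁ w₁ u₂ w₂) (o : V)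
    (hadj : ∀ x y, H.Adj x y → G.Adj x y ∨ s(x, y) = s(w₁, o))
    (hdeg : ∀ x, H.degree x ≤ G.degree x) (hu1 : H.degree u₁ ≤ 1) (hu2 : H.degree u₂ ≤ 1)
    (hA : ∀ A : Finset V, u₁ ∉ A → u₂ ∉ A → w₁ ∈ A → o ∈ A → 2 * eIn G A + 2 ≤ 3 * A.card) :
    HasStrongColoring H (3 * Δ) := by
  have hmG := (mad_le_iff G).1 hG.1.1
  have step1 : ∀ A : Finset V, u₁ ∉ A → u₂ ∉ A → 2 * eIn H A ≤ 3 * A.card := by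
    intro A h1 h2
    by_cases hin : w₁ ∈ A ∧ o ∈ A
    · have h3 := hA A h1 h2 hin.1 hin.2
      have h4 : eIn H A ≤ eIn G A + 1 := by
        unfold eIn
        refine (Finset.card_le_card ?_).trans (Finset.card_insert_le s(w₁, o) _)
        intro e he
        simp only [Finset.mem_filter, Finset.mem_insert, SimpleGraph.mem_edgeFinset] at he ⊢
        induction e with
        | h x y =>
          rcases hadj x y he.1 with h' | h'
          · exact Or.inr ⟨h', he.2⟩
          · exact Or.inl h'
      omega
    · have h4 : eIn H A ≤ eIn G A := by
        unfold eIn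
        refine Finset.card_le_card ?_
        intro e he
        simp only [Finset.mem_filter, SimpleGraph.mem_edgeFinset] at he ⊢
        induction e with
        | h x y =>
          refine ⟨(hadj x y he.1).resolve_right (fun h' => hin ?_), he.2⟩
          rw [h'] at he
          exact ⟨he.2 w₁ (by simp), he.2 o (by simp)⟩
      have := hmG A
      omega
  have er : ∀ (A : Finset V) (u : V), H.degree u ≤ 1 →
      2 * eIn H (A.erase u) ≤ 3 * (A.erase u).card → 2 * eIn H A ≤ 3 * A.card := by
    intro A u hu hle
    by_cases huA : u ∈ A
    · have h1 := eIn_le_erase H A u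
      rw [Finset.card_erase_of_mem huA] at hle
      have := Finset.card_pos.2 ⟨u, huA⟩
      omega
    · rwa [Finset.erase_eq_of_notMem huA] at hle
  have hm : ∀ A : Finset V, 2 * eIn H A ≤ 3 * A.card := by
    intro A
    refine er A u₁ hu1 (er _ u₂ hu2 (step1 _ ?_ ?_))
    · simp
    · simp
  have h3 : ¬ Has3RegularSubgraph H := by
    rintro ⟨K, hK, hKne, hK3⟩
    have hK3' : ∀ x ∈ K.support, K.degree x = 3 := by
      intro x hx
      rw [← hK3 x hx, ← SimpleGraph.card_neighborFinset_eq_degree, ← Set.ncard_coe_finset]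
      congr 1
      ext y; simp
    have hKd : ∀ x ∈ K.support, 3 ≤ G.degree x := by
      intro x hx
      rw [← hK3' x hx]
      exact (degree_mono hK x).trans (hdeg x)
    have hw : w₁ ∉ K.support := by
      intro hw
      have hsub : K.neighborFinset w₁ ⊆ insert o (badS G w₁) := by
        intro p hp
        rw [SimpleGraph.mem_neighborFinset] at hp
        by_cases hpo : p = o
        · simp [hpo]
        refine Finset.mem_insert_of_mem ?_
        by_contra hpb
        have hpG : G.Adj w₁ p := by
          refine (hadj _ _ (hK hp)).resolve_right (fun h' => hpo (Sym2.congr_right.1 h'))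
        have hpc : (core G).Adj w₁ p := by
          have : p ∈ (core G).neighborFinset w₁ := by
            rw [core_nbr_eq (deg_riv hΔ hG h.r1)]; simpa using hpG
          simpa using this
        have hpK : p ∈ K.support := ⟨w₁, hp.symm⟩
        rcases low_deg hG hpc hpb with h' | ⟨h', hpoor⟩
        · have := hKd p hpK; omega
        · obtain ⟨q, hq, hq2⟩ := poor_nbr hG hpoor
          have hs : K.neighborFinset p ⊆ G.neighborFinset p := by
            intro y hy
            rw [SimpleGraph.mem_neighborFinset] at hy ⊢
            refine (hadj _ _ (hK hy)).resolve_right (fun h' => ?_)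
            rw [Sym2.eq_iff] at h'
            rcases h' with h' | h'
            · exact hpG.ne h'.1.symm
            · exact hpo h'.1
          have heq := Finset.eq_of_subset_of_card_le hs (by
            rw [SimpleGraph.card_neighborFinset_eq_degree,
              SimpleGraph.card_neighborFinset_eq_degree, h', hK3' p hpK])
          have hqK : q ∈ K.neighborFinset p := by
            rw [heq]; simpa using core_le hq
          rw [SimpleGraph.mem_neighborFinset] at hqK
          have := hKd q ⟨p, hqK.symm⟩
          rw [deg_two hG hq2] at this
          omega
      have h1 := Finset.card_le_card hsub
      have h2 := Finset.card_insert_le o (badS G w₁)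
      rw [SimpleGraph.card_neighborFinset_eq_degree, hK3' _ hw] at h1
      have := h.r1.2.2.1
      omega
    refine hG.1.2.2 ⟨K, ?_, hKne, hK3⟩
    intro x y hxy
    refine (hadj _ _ (hK hxy)).resolve_right (fun h' => ?_)
    rw [Sym2.eq_iff] at h'
    rcases h' with h' | h'
    · exact hw (h'.1 ▸ ⟨y, hxy⟩)
    · exact hw (h'.2 ▸ ⟨x, hxy.symm⟩)
  exact hG.2.2 V H (goodB_of hG.1 hm hdeg h3)
    (Or.inl (twoPlus_lt hdeg u₁ hu1 (by rw [deg_two hG h.d1])))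

theorem deg_swap {V : Type} [Fintype V] {G H : SimpleGraph V} {x o u : V} (hu : G.Adj x u)
    (hs : ∀ y, H.Adj x y → y = o ∨ (G.Adj x y ∧ y ≠ u)) : H.degree x ≤ G.degree x := by
  have h1 : H.neighborFinset x ⊆ insert o ((G.neighborFinset x).erase u) := by
    intro y hy
    rw [SimpleGraph.mem_neighborFinset] at hy
    rcases hs y hy with h | h
    · simp [h]
    · simp [h]
  have h2 := (Finset.card_le_card h1).trans (Finset.card_insert_le _ _)
  have hm : u ∈ G.neighborFinset x := by simpa using hu
  have h3 := Finset.card_pos.2 ⟨u, hm⟩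
  rw [Finset.card_erase_of_mem hm] at h2
  rw [← SimpleGraph.card_neighborFinset_eq_degree, ← SimpleGraph.card_neighborFinset_eq_degree]
  omega

theorem caseA0 {V : Type} [Fintype V] {Δ : ℕ} (hΔ : 7 ≤ Δ) {G : SimpleGraph V}
    (hG : MinCexB Δ G) {v u₁ w₁ u₂ w₂ : V} (h : Cfg G v u₁ w₁ u₂ w₂) (hvw : G.Adj v w₁) :
    False := by
  obtain ⟨C, α, β, hC⟩ := exists_H0 hG h
  refine finish2 hΔ hG h hC ?_
  intro z₁ hz₁ z₂ hz₂ _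
  exact hC.free _ (bad_rest h hz₁) w₁ (by simp) (Or.inr hvw)

theorem caseB0 {V : Type} [Fintype V] {Δ : ℕ} (hΔ : 7 ≤ Δ) {G : SimpleGraph V}
    (hG : MinCexB Δ G) {v u₁ w₁ u₂ w₂ : V} (h : Cfg G v u₁ w₁ u₂ w₂) (hww : G.Adj w₁ w₂) :
    False := by
  obtain ⟨C, α, β, hC⟩ := exists_H0 hG h
  by_cases hb : w₂ ∈ badS G w₁ ∧ w₁ ∈ badS G w₂
  · exact finish_exotic hΔ hG h hC hb.1 hb.2
  refine finish2 hΔ hG h hC ?_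
  intro z₁ hz₁ z₂ hz₂ heq
  exfalso
  have h2 : s(w₂, z₂) ∈ restE G u₁ u₂ := by
    rw [← restE_comm]; exact bad_rest h.symm hz₂
  refine hC.val _ (bad_rest h hz₁) _ h2 ⟨?_, Or.inr ⟨s(w₁, w₂), hww, ⟨w₁, by simp, by simp⟩,
    ⟨w₂, by simp, by simp⟩⟩⟩ heq
  intro he
  rw [Sym2.eq_iff] at he
  rcases he with ⟨he, _⟩ | ⟨he1, he2⟩
  · exact hww.ne he
  · subst he1; subst he2; exact hb ⟨hz₁, hz₂⟩

theorem caseA1 {V : Type} [Fintype V] {Δ : ℕ} (hΔ : 7 ≤ Δ) {G : SimpleGraph V}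
    (hG : MinCexB Δ G) {v u₁ w₁ u₂ w₂ : V} (h : Cfg G v u₁ w₁ u₂ w₂) (hvw : ¬ G.Adj v w₁)
    (hA : ∀ A : Finset V, u₁ ∉ A → u₂ ∉ A → w₁ ∈ A → v ∈ A → 2 * eIn G A + 2 ≤ 3 * A.card) :
    False := by
  have hvu1 : G.Adj v u₁ := ((h.n1 v).2 (Or.inl rfl)).symm
  have hvu2 : G.Adj v u₂ := ((h.n2 v).2 (Or.inl rfl)).symm
  have hv1 : v ≠ u₁ := hvu1.ne
  have hv2 : v ≠ u₂ := hvu2.ne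
  have hwu1 := h.ne_w1
  have hwv := h.hw1
  have hwv2 := h.hw2
  have hx1 := h.x1
  have hx2 := h.x2
  have huu := h.hu
  set H := G.deleteEdges {s(v, u₁), s(u₁, w₁), s(u₂, w₂)} ⊔ SimpleGraph.edge v w₁ with hH
  have hadj : ∀ x y, H.Adj x y ↔ (G.Adj x y ∧ s(x, y) ≠ s(v, u₁) ∧ s(x, y) ≠ s(u₁, w₁) ∧
      s(x, y) ≠ s(u₂, w₂)) ∨ s(x, y) = s(v, w₁) := by
    intro x y
    rw [hH, SimpleGraph.sup_adj, SimpleGraph.deleteEdges_adj, SimpleGraph.edge_adj]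
    simp only [Set.mem_insert_iff, Set.mem_singleton_iff, not_or, ne_eq]
    refine or_congr Iff.rfl ?_
    rw [Sym2.eq_iff]
    constructor
    · rintro ⟨h', _⟩; tauto
    · intro h'
      refine ⟨by tauto, ?_⟩
      rintro rfl
      rcases h' with ⟨a, b⟩ | ⟨a, b⟩
      · exact hwv (a.symm.trans b)
      · exact hwv (b.symm.trans a)
  have hu1 : ∀ x, ¬ H.Adj u₁ x := by
    intro x hx
    rw [hadj] at hx
    rcases hx with ⟨ha, hb, hc, _⟩ | hx
    · rcases (h.n1 x).1 ha with rfl | rfl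
      · exact hb Sym2.eq_swap
      · exact hc rfl
    · rw [Sym2.eq_iff] at hx
      rcases hx with hx | hx
      · exact hv1 hx.1.symm
      · exact hwu1 hx.1.symm
  have hu2 : ∀ x, H.Adj u₂ x → x = v := by
    intro x hx
    rw [hadj] at hx
    rcases hx with ⟨ha, _, _, hb⟩ | hx
    · rcases (h.n2 x).1 ha with rfl | rfl
      · rfl
      · exact absurd rfl hb
    · rw [Sym2.eq_iff] at hx
      rcases hx with hx | hx
      · exact absurd hx.1.symm hv2
      · exact hx.2
  have hHG : ∀ x y, H.Adj x y → G.Adj x y ∨ s(x, y) = s(w₁, v) := by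
    intro x y hxy
    rcases (hadj x y).1 hxy with h' | h'
    · exact Or.inl h'.1
    · exact Or.inr (h'.trans Sym2.eq_swap)
  obtain ⟨C, hC⟩ := good_H hΔ hG h v hHG (by
      intro x
      by_cases hxv : x = v
      · subst hxv
        refine deg_swap (o := w₁) hvu1 ?_
        intro y hy
        rcases hHG x y hy with h' | h'
        · refine Or.inr ⟨h', ?_⟩
          rintro rfl
          exact hu1 x hy.symm
        · rw [Sym2.eq_iff] at h'
          rcases h' with h' | h'
          · exact absurd h'.1 hwv
          · exact Or.inl h'.2
      by_cases hxw : x = w₁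
      · subst hxw
        refine deg_swap (o := v) (core_le h.c1) ?_
        intro y hy
        rcases hHG x y hy with h' | h'
        · refine Or.inr ⟨h', ?_⟩
          rintro rfl
          exact hu1 x hy.symm
        · exact Or.inl (Sym2.congr_right.1 h')
      refine Finset.card_le_card ?_
      intro y hy
      rw [SimpleGraph.mem_neighborFinset] at hy ⊢
      refine (hHG x y hy).resolve_right ?_
      intro h'
      rw [Sym2.eq_iff] at h'
      tauto)
    (deg_le_one (v := v) (fun x hx => absurd hx (hu1 x))) (deg_le_one hu2) hA
  have hHvw : H.Adj v w₁ := (hadj _ _).2 (Or.inr rfl)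
  have hHvu : H.Adj v u₂ := by
    rw [hadj]
    refine Or.inl ⟨hvu2, ?_, ?_, ?_⟩ <;>
    · intro he; rw [Sym2.eq_iff] at he; tauto
  have hnr : s(v, w₁) ∉ restE G u₁ u₂ := fun h' => hvw h'.1
  have hmap : ∀ x y, x ≠ u₁ → x ≠ u₂ → y ≠ u₁ → y ≠ u₂ → G.Adj x y → H.Adj x y := by
    intro x y a b c d hxy
    rw [hadj]
    refine Or.inl ⟨hxy, ?_, ?_, ?_⟩ <;>
    · intro he; rw [Sym2.eq_iff] at he; tauto
  have hP := precol_of_H h hmap hC hHvw hHvu hx1 hnr u2_not_rest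
  refine finish2 hΔ hG h hP ?_
  intro z₁ hz₁ z₂ hz₂ _
  have hr := bad_rest h hz₁
  have hsub := (valid_of_H hmap hC).1 hr
  exact ⟨free_of_H hC hHvw hsub (fun h' => hnr (h' ▸ hr)) (x := w₁) (by simp) (Or.inr hHvw),
    free_of_H hC hHvu hsub (fun h' => u2_not_rest (h' ▸ hr)) (x := w₁) (by simp) (Or.inr hHvw)⟩

theorem caseB1 {V : Type} [Fintype V] {Δ : ℕ} (hΔ : 7 ≤ Δ) {G : SimpleGraph V}
    (hG : MinCexB Δ G) {v u₁ w₁ u₂ w₂ : V} (h : Cfg G v u₁ w₁ u₂ w₂) (hne : w₁ ≠ w₂)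
    (hww : ¬ G.Adj w₁ w₂)
    (hA : ∀ A : Finset V, u₁ ∉ A → u₂ ∉ A → w₁ ∈ A → w₂ ∈ A → 2 * eIn G A + 2 ≤ 3 * A.card) :
    False := by
  have hvu1 : G.Adj v u₁ := ((h.n1 v).2 (Or.inl rfl)).symm
  have hvu2 : G.Adj v u₂ := ((h.n2 v).2 (Or.inl rfl)).symm
  have hv1 : v ≠ u₁ := hvu1.ne
  have hv2 : v ≠ u₂ := hvu2.ne
  have hwu1 := h.ne_w1
  have hwu2 := h.symm.ne_w1
  have hwv := h.hw1
  have hwv2 := h.hw2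
  have hx1 := h.x1
  have hx2 := h.x2
  have huu := h.hu
  set H := G.deleteEdges {s(u₁, w₁), s(u₂, w₂)} ⊔ SimpleGraph.edge w₁ w₂ with hH
  have hadj : ∀ x y, H.Adj x y ↔ (G.Adj x y ∧ s(x, y) ≠ s(u₁, w₁) ∧
      s(x, y) ≠ s(u₂, w₂)) ∨ s(x, y) = s(w₁, w₂) := by
    intro x y
    rw [hH, SimpleGraph.sup_adj, SimpleGraph.deleteEdges_adj, SimpleGraph.edge_adj]
    simp only [Set.mem_insert_iff, Set.mem_singleton_iff, not_or, ne_eq]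
    refine or_congr Iff.rfl ?_
    rw [Sym2.eq_iff]
    constructor
    · rintro ⟨h', _⟩; tauto
    · intro h'
      refine ⟨by tauto, ?_⟩
      rintro rfl
      rcases h' with ⟨a, b⟩ | ⟨a, b⟩
      · exact hne (a.symm.trans b)
      · exact hne (b.symm.trans a)
  have hu1 : ∀ x, H.Adj u₁ x → x = v := by
    intro x hx
    rw [hadj] at hx
    rcases hx with ⟨ha, hb, _⟩ | hx
    · rcases (h.n1 x).1 ha with rfl | rfl
      · rfl
      · exact absurd rfl hb
    · rw [Sym2.eq_iff] at hx
      rcases hx with hx | hx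
      · exact absurd hx.1.symm hwu1
      · exact absurd hx.1.symm hx2
  have hu2 : ∀ x, H.Adj u₂ x → x = v := by
    intro x hx
    rw [hadj] at hx
    rcases hx with ⟨ha, _, hb⟩ | hx
    · rcases (h.n2 x).1 ha with rfl | rfl
      · rfl
      · exact absurd rfl hb
    · rw [Sym2.eq_iff] at hx
      rcases hx with hx | hx
      · exact absurd hx.1.symm hx1
      · exact absurd hx.1.symm hwu2
  have hHG : ∀ x y, H.Adj x y → G.Adj x y ∨ s(x, y) = s(w₁, w₂) := by
    intro x y hxy
    rcases (hadj x y).1 hxy with h' | h'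
    · exact Or.inl h'.1
    · exact Or.inr h'
  obtain ⟨C, hC⟩ := good_H hΔ hG h w₂ hHG (by
      intro x
      by_cases hxv : x = w₂
      · subst hxv
        refine deg_swap (o := w₁) (core_le h.c2) ?_
        intro y hy
        rcases hHG x y hy with h' | h'
        · refine Or.inr ⟨h', ?_⟩
          rintro rfl
          exact hwv2 (hu2 x hy.symm).symm
        · rw [Sym2.eq_iff] at h'
          rcases h' with h' | h'
          · exact absurd h'.1.symm hne
          · exact Or.inl h'.2
      by_cases hxw : x = w₁
      · subst hxw
        refine deg_swap (o := w₂) (core_le h.c1) ?_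
        intro y hy
        rcases hHG x y hy with h' | h'
        · refine Or.inr ⟨h', ?_⟩
          rintro rfl
          exact hwv (hu1 x hy.symm).symm
        · exact Or.inl (Sym2.congr_right.1 h')
      refine Finset.card_le_card ?_
      intro y hy
      rw [SimpleGraph.mem_neighborFinset] at hy ⊢
      refine (hHG x y hy).resolve_right ?_
      intro h'
      rw [Sym2.eq_iff] at h'
      tauto)
    (deg_le_one hu1) (deg_le_one hu2) hA
  have hHww : H.Adj w₁ w₂ := (hadj _ _).2 (Or.inr rfl)
  have hHvu1 : H.Adj v u₁ := by
    rw [hadj]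
    refine Or.inl ⟨hvu1, ?_, ?_⟩ <;>
    · intro he; rw [Sym2.eq_iff] at he; tauto
  have hHvu2 : H.Adj v u₂ := by
    rw [hadj]
    refine Or.inl ⟨hvu2, ?_, ?_⟩ <;>
    · intro he; rw [Sym2.eq_iff] at he; tauto
  have hmap : ∀ x y, x ≠ u₁ → x ≠ u₂ → y ≠ u₁ → y ≠ u₂ → G.Adj x y → H.Adj x y := by
    intro x y a b c d hxy
    rw [hadj]
    refine Or.inl ⟨hxy, ?_, ?_⟩ <;>
    · intro he; rw [Sym2.eq_iff] at he; tauto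
  have hP := precol_of_H h hmap hC hHvu1 hHvu2 huu u1_not_rest u2_not_rest
  refine finish2 hΔ hG h hP ?_
  intro z₁ hz₁ z₂ hz₂ heq
  exfalso
  have hsub := (valid_of_H hmap hC).1
  have h2 : s(w₂, z₂) ∈ restE G u₁ u₂ := by
    rw [← restE_comm]; exact bad_rest h.symm hz₂
  refine hC _ (hsub (bad_rest h hz₁)) _ (hsub h2) ⟨?_, Or.inr ⟨s(w₁, w₂), hHww,
    ⟨w₁, by simp, by simp⟩, ⟨w₂, by simp, by simp⟩⟩⟩ heq
  intro he
  rw [Sym2.eq_iff] at he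
  rcases he with ⟨he, _⟩ | ⟨he1, he2⟩
  · exact hne he
  · subst he2; exact hww (bad_adj hz₁)

theorem dens {V : Type} [Fintype V] {Δ : ℕ} {G : SimpleGraph V}
    (hG : MinCexB Δ G) {v u₁ w₁ u₂ w₂ : V} (h : Cfg G v u₁ w₁ u₂ w₂) (A : Finset V)
    (h1 : u₁ ∉ A) (h2 : u₂ ∉ A) (hv : v ∈ A) (hw1 : w₁ ∈ A) (hw2 : w₂ ∈ A) :
    2 * eIn G A + 2 ≤ 3 * A.card := by
  have huu := h.hu
  have hm := (mad_le_iff G).1 hG.1.1 (insert u₁ (insert u₂ A))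
  rw [Finset.card_insert_of_notMem (by simp [huu, h1]), Finset.card_insert_of_notMem h2] at hm
  have hv1 : v ≠ u₁ := fun e => h1 (e ▸ hv)
  have hv2 : v ≠ u₂ := fun e => h2 (e ▸ hv)
  have ha1 : w₁ ≠ u₁ := fun e => h1 (e ▸ hw1)
  have ha2 : w₂ ≠ u₂ := fun e => h2 (e ▸ hw2)
  have hx1 := h.x1
  have hx2 := h.x2
  have hwv := h.hw1
  have hwv2 := h.hw2
  have key : eIn G A + 4 ≤ eIn G (insert u₁ (insert u₂ A)) := by
    unfold eIn
    have hd : Disjoint (G.edgeFinset.filter (fun e => ∀ x ∈ e, x ∈ A))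
        ({s(u₁, v), s(u₁, w₁), s(u₂, v), s(u₂, w₂)} : Finset (Sym2 V)) := by
      rw [Finset.disjoint_left]
      intro e he he'
      have h3 := (Finset.mem_filter.1 he).2
      simp only [Finset.mem_insert, Finset.mem_singleton] at he'
      rcases he' with rfl | rfl | rfl | rfl
      · exact h1 (h3 u₁ (by simp))
      · exact h1 (h3 u₁ (by simp))
      · exact h2 (h3 u₂ (by simp))
      · exact h2 (h3 u₂ (by simp))
    have hc : ({s(u₁, v), s(u₁, w₁), s(u₂, v), s(u₂, w₂)} : Finset (Sym2 V)).card = 4 := by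
      have e1 : s(u₁, v) ≠ s(u₁, w₁) := fun e => hwv (Sym2.congr_right.1 e)
      have e2 : s(u₂, v) ≠ s(u₂, w₂) := fun e => hwv2 (Sym2.congr_right.1 e)
      have e3 : ∀ x y, x ≠ u₂ → s(u₁, x) ≠ s(u₂, y) := by
        intro x y hx e
        rw [Sym2.eq_iff] at e
        rcases e with e | e
        · exact huu e.1
        · exact hx e.2
      rw [Finset.card_insert_of_notMem, Finset.card_insert_of_notMem, Finset.card_pair e2]
      · simp only [Finset.mem_insert, Finset.mem_singleton, not_or]
        exact ⟨e3 _ _ hx1, e3 _ _ hx1⟩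
      · simp only [Finset.mem_insert, Finset.mem_singleton, not_or]
        exact ⟨e1, e3 _ _ hv2, e3 _ _ hv2⟩
    rw [← hc, ← Finset.card_union_of_disjoint hd]
    refine Finset.card_le_card ?_
    intro e he
    rw [Finset.mem_union] at he
    rw [Finset.mem_filter, SimpleGraph.mem_edgeFinset]
    rcases he with he | he
    · rw [Finset.mem_filter, SimpleGraph.mem_edgeFinset] at he
      exact ⟨he.1, fun x hx => by simp [he.2 x hx]⟩
    · simp only [Finset.mem_insert, Finset.mem_singleton] at he
      rcases he with rfl | rfl | rfl | rfl
      · exact ⟨(h.n1 _).2 (Or.inl rfl), by simp [hv]⟩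
      · exact ⟨(h.n1 _).2 (Or.inr rfl), by simp [hw1]⟩
      · exact ⟨(h.n2 _).2 (Or.inl rfl), by simp [hv]⟩
      · exact ⟨(h.n2 _).2 (Or.inr rfl), by simp [hw2]⟩
  omega

theorem tri {V : Type} [Fintype V] {Δ : ℕ} {G : SimpleGraph V}
    (hG : MinCexB Δ G) {v u₁ w₁ u₂ w₂ : V} (h : Cfg G v u₁ w₁ u₂ w₂) :
    (∀ A : Finset V, u₁ ∉ A → u₂ ∉ A → w₁ ∈ A → v ∈ A → 2 * eIn G A + 2 ≤ 3 * A.card) ∨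
    (∀ A : Finset V, u₁ ∉ A → u₂ ∉ A → w₂ ∈ A → v ∈ A → 2 * eIn G A + 2 ≤ 3 * A.card) ∨
    (∀ A : Finset V, u₁ ∉ A → u₂ ∉ A → w₁ ∈ A → w₂ ∈ A → 2 * eIn G A + 2 ≤ 3 * A.card) := by
  by_contra! hcon
  obtain ⟨⟨A, a1, a2, a3, a4, a5⟩, ⟨B, b1, b2, b3, b4, b5⟩, ⟨D, d1, d2, d3, d4, d5⟩⟩ := hcon
  have hm := (mad_le_iff G).1 hG.1.1
  have sAB := eIn_super G A B
  have sAD := eIn_super G A D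
  have sBD := eIn_super G B D
  have cAB := Finset.card_union_add_card_inter A B
  have cAD := Finset.card_union_add_card_inter A D
  have cBD := Finset.card_union_add_card_inter B D
  have dAB := dens hG h (A ∪ B) (by simp [*]) (by simp [*]) (by simp [*]) (by simp [*])
    (by simp [*])
  have dAD := dens hG h (A ∪ D) (by simp [*]) (by simp [*]) (by simp [*]) (by simp [*])
    (by simp [*])
  have dBD := dens hG h (B ∪ D) (by simp [*]) (by simp [*]) (by simp [*]) (by simp [*])
    (by simp [*])
  have s1 := eIn_super G (A ∩ B) (A ∩ D)
  have c1 := Finset.card_union_add_card_inter (A ∩ B) (A ∩ D)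
  have m1 := hm ((A ∩ B) ∩ (A ∩ D))
  have s2 := eIn_super G ((A ∩ B) ∪ (A ∩ D)) (B ∩ D)
  have c2 := Finset.card_union_add_card_inter ((A ∩ B) ∪ (A ∩ D)) (B ∩ D)
  have m2 := hm (((A ∩ B) ∪ (A ∩ D)) ∩ (B ∩ D))
  have dd := dens hG h (((A ∩ B) ∪ (A ∩ D)) ∪ (B ∩ D)) (by simp [*]) (by simp [*]) (by simp [*])
    (by simp [*]) (by simp [*])
  omega

theorem nbrs {V : Type} [Fintype V] {Δ : ℕ} {G : SimpleGraph V} (hG : MinCexB Δ G)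
    {u v w : V} (h : VeryPoorWith G u v w) (x : V) : G.Adj u x ↔ x = v ∨ x = w := by
  obtain ⟨hu, huv, huw, hvw, -⟩ := h
  have hs : ({v, w} : Finset V) ⊆ G.neighborFinset u := by
    intro y hy
    simp only [Finset.mem_insert, Finset.mem_singleton] at hy
    rw [SimpleGraph.mem_neighborFinset]
    rcases hy with rfl | rfl
    · exact core_le huv
    · exact core_le huw
  have he := Finset.eq_of_subset_of_card_le hs (by
    rw [SimpleGraph.card_neighborFinset_eq_degree, deg_two hG hu, Finset.card_pair hvw])
  rw [← SimpleGraph.mem_neighborFinset, ← he]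
  simp

theorem no_tri {V : Type} [Fintype V] {Δ : ℕ} (hΔ : 7 ≤ Δ) {G : SimpleGraph V}
    (hG : MinCexB Δ G) {v u₁ w₁ u₂ w₂ : V}
    (h1 : VeryPoorWith G u₁ v w₁) (h2 : VeryPoorWith G u₂ v w₂) : w₁ ≠ u₂ := by
  rintro rfl
  have n1 := nbrs hG h1
  have n2 := nbrs hG h2
  have hadj : G.Adj u₁ w₁ := (n1 _).2 (Or.inr rfl)
  have hv1 : u₁ ≠ v := ((n1 v).2 (Or.inl rfl)).ne
  have hw2 : w₂ = u₁ := by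
    rcases (n2 _).1 hadj.symm with h' | h'
    · exact absurd h' hv1
    · exact h'.symm
  subst hw2
  have e1 : ∀ a, G.Adj w₂ a → a ≠ w₁ → a = v := fun a ha hn => ((n1 a).1 ha).resolve_right hn
  have e2 : ∀ a, G.Adj w₁ a → a ≠ w₂ → a = v := fun a ha hn => ((n2 a).1 ha).resolve_right hn
  have hl := edge_lemma hG hadj (fun a b ha han hb hbn =>
    (e1 a ha han).trans (e2 b hb hbn).symm)
  have c1 : ((G.neighborFinset w₂).erase w₁).card ≤ 1 := by
    rw [Finset.card_erase_of_mem (by simpa using hadj), SimpleGraph.card_neighborFinset_eq_degree,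
      deg_two hG h1.1]
  have c2 : ((G.neighborFinset w₁).erase w₂).card ≤ 1 := by
    rw [Finset.card_erase_of_mem (by simpa using hadj.symm),
      SimpleGraph.card_neighborFinset_eq_degree, deg_two hG h2.1]
  have s1 := (sum_le_card hG ((G.neighborFinset w₂).erase w₁)).trans (Nat.mul_le_mul_right Δ c1)
  have s2 := (sum_le_card hG ((G.neighborFinset w₁).erase w₂)).trans (Nat.mul_le_mul_right Δ c2)
  omega

/-- In a minimal counterexample `G` to `χ'_s ≤ 3Δ` (`Mad ≤ 3`, maximum degree at most
`Δ ≥ 7`, no 3-regular subgraph), no vertex is a sponsor of two distinct very poor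
vertices. -/
theorem minCexB_no_double_sponsor (Δ : ℕ) (hΔ : 7 ≤ Δ) {V : Type} [Fintype V]
    (G : SimpleGraph V) (hG : MinCexB Δ G) (v u₁ w₁ u₂ w₂ : V)
    (h1 : VeryPoorWith G u₁ v w₁) (h2 : VeryPoorWith G u₂ v w₂) :
    u₁ = u₂ := by
  by_contra hne
  have h : Cfg G v u₁ w₁ u₂ w₂ :=
    { hu := hne
      n1 := nbrs hG h1
      n2 := nbrs hG h2
      hw1 := h1.2.2.2.1
      hw2 := h2.2.2.2.1
      c1 := h1.2.2.1.symm
      c2 := h2.2.2.1.symm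
      d1 := h1.1
      d2 := h2.1
      r1 := riv_of h1
      r2 := riv_of h2
      x1 := no_tri hΔ hG h1 h2
      x2 := no_tri hΔ hG h2 h1 }
  by_cases a1 : G.Adj v w₁
  · exact caseA0 hΔ hG h a1
  by_cases a2 : G.Adj v w₂
  · exact caseA0 hΔ hG h.symm a2
  by_cases hw : w₁ = w₂
  · exact caseA1 hΔ hG h a1 (fun A b1 b2 b3 b4 => dens hG h A b1 b2 b4 b3 (hw ▸ b3))
  by_cases a3 : G.Adj w₁ w₂
  · exact caseB0 hΔ hG h a3
  rcases tri hG h with ht | ht | ht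
  · exact caseA1 hΔ hG h a1 ht
  · exact caseA1 hΔ hG h.symm a2 (fun A b1 b2 b3 b4 => ht A b2 b1 b3 b4)
  · exact caseB1 hΔ hG h hw a3 ht

end StrongEC
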